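/- arXiv:1505.03883 — 16 statements merged into one kernel-verified Lean document; each statement's English description precedes it below -/
import Mathlib

section
/- Let k ≥ 2 be an integer and assume Σ_{i=1}^{k-1} α_i U_i ≤ 1 and Σ_{i=1}^{k-1} β_i C_i ≤ t_k. If C_k/t_k ≤ 1 − Σ_{i=1}^{k-1} α_i U_i − (Σ_{i=1}^{k-1} (β_i C_i − α_i U_i · (Σ_{ℓ=i}^{k-1} β_ℓ C_ℓ)))/t_k, then the k-point last-release test passes, i.e., for every choice of reals t_1,…,t_{k-1} with 0 ≤ t_1 ≤ t_2 ≤ … ≤ t_{k-1} ≤ t_k there exists an index j ∈ {1,…,k} such that C_k + Σ_{i=1}^{k-1} α_i t_i U_i + Σ_{i=1}^{j-1} β_i C_i ≤ t_j (where for j = k the point is t_k itself). -/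
open Finset

/-- Lemma 1 of the k²Q framework: the quadratic bound implies that the
k-point last-release schedulability test passes. -/
theorem stmt0 (k : ℕ) (hk : 2 ≤ k) (α β U C : ℕ → ℝ)
    (hα : ∀ i ∈ Finset.Icc 1 (k - 1), 0 < α i)
    (hβ : ∀ i ∈ Finset.Icc 1 (k - 1), 0 < β i)
    (hU : ∀ i ∈ Finset.Icc 1 (k - 1), 0 < U i)
    (hC : ∀ i ∈ Finset.Icc 1 (k - 1), 0 ≤ C i)
    (Ck tk : ℝ) (hCk : 0 < Ck) (htk : 0 < tk)
    (hsumU : ∑ i ∈ Finset.Icc 1 (k - 1), α i * U i ≤ 1)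
    (hsumC : ∑ i ∈ Finset.Icc 1 (k - 1), β i * C i ≤ tk)
    (hcond : Ck / tk ≤ 1 - (∑ i ∈ Finset.Icc 1 (k - 1), α i * U i)
      - (∑ i ∈ Finset.Icc 1 (k - 1),
          (β i * C i - α i * U i * ∑ l ∈ Finset.Icc i (k - 1), β l * C l)) / tk) :
    ∀ t : ℕ → ℝ, t k = tk → 0 ≤ t 1 →
      (∀ i, 1 ≤ i → i < k → t i ≤ t (i + 1)) →
      ∃ j ∈ Finset.Icc 1 k,
        Ck + (∑ i ∈ Finset.Icc 1 (k - 1), α i * t i * U i)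
          + (∑ i ∈ Finset.Icc 1 (j - 1), β i * C i) ≤ t j := by
  intro t ht _ _
  by_contra hcon
  push Not at hcon
  have hS : ∀ i ∈ Finset.Icc 1 (k - 1), ∑ l ∈ Finset.Icc i (k - 1), β l * C l
      = (∑ l ∈ Finset.Icc 1 (k - 1), β l * C l) - ∑ l ∈ Finset.Icc 1 (i - 1), β l * C l := by
    intro i hi
    rw [Finset.mem_Icc] at hi
    have hd : Disjoint (Finset.Icc 1 (i - 1)) (Finset.Icc i (k - 1)) := by
      rw [Finset.disjoint_left]
      intro x hx hy
      rw [Finset.mem_Icc] at hx hy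
      omega
    have hu : Finset.Icc 1 (k - 1) = Finset.Icc 1 (i - 1) ∪ Finset.Icc i (k - 1) := by
      ext x
      simp only [Finset.mem_union, Finset.mem_Icc]
      omega
    rw [hu, Finset.sum_union hd]
    ring
  set B := ∑ l ∈ Finset.Icc 1 (k - 1), β l * C l with hB
  set A := ∑ i ∈ Finset.Icc 1 (k - 1), α i * U i with hA
  set X := Ck + ∑ i ∈ Finset.Icc 1 (k - 1), α i * t i * U i with hX
  have h1 : ∑ i ∈ Finset.Icc 1 (k - 1),
      (β i * C i - α i * U i * ∑ l ∈ Finset.Icc i (k - 1), β l * C l)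
      = B - A * B + ∑ i ∈ Finset.Icc 1 (k - 1),
        α i * U i * ∑ l ∈ Finset.Icc 1 (i - 1), β l * C l := by
    rw [hA, Finset.sum_mul]
    nth_rewrite 2 [hB]
    rw [← Finset.sum_sub_distrib, ← Finset.sum_add_distrib]
    apply Finset.sum_congr rfl
    intro i hi
    rw [hS i hi]
    ring
  have h2 : ∑ i ∈ Finset.Icc 1 (k - 1), α i * t i * U i
      < A * X + ∑ i ∈ Finset.Icc 1 (k - 1),
        α i * U i * ∑ l ∈ Finset.Icc 1 (i - 1), β l * C l := by
    rw [hA, Finset.sum_mul, ← Finset.sum_add_distrib]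
    apply Finset.sum_lt_sum_of_nonempty
    · exact ⟨1, Finset.mem_Icc.2 ⟨le_refl _, by omega⟩⟩
    · intro i hi
      have h := hcon i (by rw [Finset.mem_Icc] at hi ⊢; omega)
      have := mul_lt_mul_of_pos_left h (mul_pos (hα i hi) (hU i hi))
      linarith
  have h3 := hcon k (by rw [Finset.mem_Icc]; omega)
  rw [ht] at h3
  rw [h1] at hcond
  have h4 := mul_le_mul_of_nonneg_right hcond htk.le
  rw [sub_mul, div_mul_cancel₀ _ htk.ne', div_mul_cancel₀ _ htk.ne'] at h4
  have h5 : 0 ≤ (1 - A) * (X + B - tk) :=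
    mul_nonneg (by linarith) (by linarith)
  nlinarith
end

section
/- Let k ≥ 2 be an integer and assume Σ_{i=1}^{k-1} α_i U_i ≤ 1 and Σ_{i=1}^{k-1} β_i C_i ≤ t_k. Then for every real t* with t* ≥ t_k and all reals t_1,…,t_{k-1} satisfying 0 ≤ t_j and t_j ≤ t* − Σ_{ℓ=j}^{k-1} β_ℓ C_ℓ for every j = 1,…,k−1, one has t* − Σ_{i=1}^{k-1}(α_i U_i t_i + β_i C_i) ≥ t_k · (1 − Σ_{i=1}^{k-1} α_i U_i) − Σ_{i=1}^{k-1} (β_i C_i − α_i U_i · (Σ_{ℓ=i}^{k-1} β_ℓ C_ℓ)). -/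
open Finset

/-- The key linear-programming bound in the proof of Lemma 1 of the k²Q framework:
over the relaxed feasible region, the objective is bounded below by the value at the
extreme point t_j = t_k − Σ_{ℓ=j}^{k−1} β_ℓ C_ℓ. -/
theorem stmt1 (k : ℕ) (hk : 2 ≤ k) (α β U C : ℕ → ℝ)
    (hα : ∀ i ∈ Finset.Icc 1 (k - 1), 0 < α i)
    (hβ : ∀ i ∈ Finset.Icc 1 (k - 1), 0 < β i)
    (hU : ∀ i ∈ Finset.Icc 1 (k - 1), 0 < U i)
    (hC : ∀ i ∈ Finset.Icc 1 (k - 1), 0 ≤ C i)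
    (Ck tk : ℝ) (hCk : 0 < Ck) (htk : 0 < tk)
    (hsumU : ∑ i ∈ Finset.Icc 1 (k - 1), α i * U i ≤ 1)
    (hsumC : ∑ i ∈ Finset.Icc 1 (k - 1), β i * C i ≤ tk) :
    ∀ tstar : ℝ, tk ≤ tstar →
    ∀ t : ℕ → ℝ,
      (∀ j ∈ Finset.Icc 1 (k - 1), 0 ≤ t j) →
      (∀ j ∈ Finset.Icc 1 (k - 1),
        t j ≤ tstar - ∑ l ∈ Finset.Icc j (k - 1), β l * C l) →
      tstar - (∑ i ∈ Finset.Icc 1 (k - 1), (α i * U i * t i + β i * C i)) ≥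
        tk * (1 - ∑ i ∈ Finset.Icc 1 (k - 1), α i * U i)
          - ∑ i ∈ Finset.Icc 1 (k - 1),
              (β i * C i - α i * U i * ∑ l ∈ Finset.Icc i (k - 1), β l * C l) := by
  intro tstar hts t _ ht
  have h1 : ∑ i ∈ Finset.Icc 1 (k - 1), α i * U i * t i ≤
      ∑ i ∈ Finset.Icc 1 (k - 1),
        (α i * U i * tstar - α i * U i * ∑ l ∈ Finset.Icc i (k - 1), β l * C l) := by
    apply Finset.sum_le_sum
    intro i hi
    rw [← mul_sub]
    exact mul_le_mul_of_nonneg_left (ht i hi) (mul_pos (hα i hi) (hU i hi)).le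
  rw [Finset.sum_sub_distrib, ← Finset.sum_mul] at h1
  rw [Finset.sum_add_distrib, Finset.sum_sub_distrib]
  have h2 := mul_nonneg (sub_nonneg.2 hts) (sub_nonneg.2 hsumU)
  linarith
end

section
/- Let k ≥ 2 be an integer and suppose the indices are ordered so that β_1 C_1/(α_1 U_1) ≥ β_2 C_2/(α_2 U_2) ≥ … ≥ β_{k-1} C_{k-1}/(α_{k-1} U_{k-1}). Then for every permutation σ of {1,…,k−1}: Σ_{i=1}^{k-1} α_i U_i · (Σ_{ℓ=i}^{k-1} β_ℓ C_ℓ) ≤ Σ_{i=1}^{k-1} α_{σ(i)} U_{σ(i)} · (Σ_{ℓ=i}^{k-1} β_{σ(ℓ)} C_{σ(ℓ)}). Hence ordering the k−1 higher-priority tasks in non-increasing order of β_i C_i/(α_i U_i) minimizes the right-hand side of the quadratic schedulability bound, i.e., it is the worst-case last release time ordering. -/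
open Finset

theorem aux_sym (n : ℕ) (a b : ℕ → ℝ) :
    2 * (∑ i ∈ Finset.Icc 1 n, a i * ∑ l ∈ Finset.Icc i n, b l) =
      ∑ i ∈ Finset.Icc 1 n, ∑ l ∈ Finset.Icc 1 n,
        ((if i ≤ l then a i * b l else 0) + (if l ≤ i then a l * b i else 0)) := by
  have h1 : (∑ i ∈ Finset.Icc 1 n, a i * ∑ l ∈ Finset.Icc i n, b l) =
      ∑ i ∈ Finset.Icc 1 n, ∑ l ∈ Finset.Icc 1 n, (if i ≤ l then a i * b l else 0) := by
    refine Finset.sum_congr rfl fun i hi => ?_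
    rw [Finset.mul_sum, ← Finset.sum_filter]
    refine Finset.sum_congr ?_ fun _ _ => rfl
    ext l
    simp only [Finset.mem_Icc, Finset.mem_filter] at *
    omega
  have h2 : (∑ i ∈ Finset.Icc 1 n, ∑ l ∈ Finset.Icc 1 n, (if l ≤ i then a l * b i else 0)) =
      ∑ i ∈ Finset.Icc 1 n, ∑ l ∈ Finset.Icc 1 n, (if i ≤ l then a i * b l else 0) :=
    Finset.sum_comm
  simp only [Finset.sum_add_distrib]
  rw [h2, h1]
  ring

/-- Lemma 2 of the k²Q framework: ordering the k−1 higher-priority tasks in a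
non-increasing order of β_i C_i/(α_i U_i) minimizes the quadratic term, i.e. it is
the worst-case last release time ordering. -/
theorem stmt2 (k : ℕ) (hk : 2 ≤ k) (α β U C : ℕ → ℝ)
    (hα : ∀ i ∈ Finset.Icc 1 (k - 1), 0 < α i)
    (hβ : ∀ i ∈ Finset.Icc 1 (k - 1), 0 < β i)
    (hU : ∀ i ∈ Finset.Icc 1 (k - 1), 0 < U i)
    (hC : ∀ i ∈ Finset.Icc 1 (k - 1), 0 ≤ C i)
    (hord : ∀ i ∈ Finset.Icc 1 (k - 1), ∀ j ∈ Finset.Icc 1 (k - 1), i ≤ j →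
      β j * C j / (α j * U j) ≤ β i * C i / (α i * U i)) :
    ∀ σ : Equiv.Perm ℕ, (∀ i ∈ Finset.Icc 1 (k - 1), σ i ∈ Finset.Icc 1 (k - 1)) →
      (∑ i ∈ Finset.Icc 1 (k - 1),
          α i * U i * ∑ l ∈ Finset.Icc i (k - 1), β l * C l) ≤
        ∑ i ∈ Finset.Icc 1 (k - 1),
          α (σ i) * U (σ i) * ∑ l ∈ Finset.Icc i (k - 1), β (σ l) * C (σ l) := by
  intro σ hσ
  generalize k - 1 = n at *
  have himg : (Finset.Icc 1 n).image σ = Finset.Icc 1 n := by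
    apply Finset.eq_of_subset_of_card_le
    · intro x hx
      obtain ⟨i, hi, rfl⟩ := Finset.mem_image.mp hx
      exact hσ i hi
    · rw [Finset.card_image_of_injective _ σ.injective]
  have hre : ∀ f : ℕ → ℝ, ∑ i ∈ Finset.Icc 1 n, f i = ∑ i ∈ Finset.Icc 1 n, f (σ i) := by
    intro f
    conv_lhs => rw [← himg]
    exact Finset.sum_image fun x _ y _ h => σ.injective h
  have key : ∀ i ∈ Finset.Icc 1 n, ∀ j ∈ Finset.Icc 1 n, i ≤ j →
      (α i * U i) * (β j * C j) ≤ (α j * U j) * (β i * C i) := by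
    intro i hi j hj hij
    have h := hord i hi j hj hij
    rw [div_le_div_iff₀ (mul_pos (hα j hj) (hU j hj)) (mul_pos (hα i hi) (hU i hi))] at h
    linarith
  have hR := aux_sym n (fun i => α (σ i) * U (σ i)) (fun i => β (σ i) * C (σ i))
  suffices h : 2 * (∑ i ∈ Finset.Icc 1 n, α i * U i * ∑ l ∈ Finset.Icc i n, β l * C l) ≤
      2 * (∑ i ∈ Finset.Icc 1 n,
          α (σ i) * U (σ i) * ∑ l ∈ Finset.Icc i n, β (σ l) * C (σ l)) by linarith
  rw [aux_sym n (fun i => α i * U i) (fun i => β i * C i), hR, hre]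
  refine Finset.sum_le_sum fun i hi => ?_
  rw [hre]
  refine Finset.sum_le_sum fun j hj => ?_
  have hi' := hσ i hi
  have hj' := hσ j hj
  rcases lt_trichotomy i j with h | h | h
  · rw [if_pos h.le, if_neg (not_le.mpr h)]
    rcases lt_or_gt_of_ne (fun e => h.ne (σ.injective e) : σ i ≠ σ j) with g | g
    · rw [if_pos g.le, if_neg (not_le.mpr g)]
    · rw [if_neg (not_le.mpr g), if_pos g.le]
      have := key _ hj' _ hi' g.le
      linarith
  · subst h
    simp
  · rw [if_pos h.le, if_neg (not_le.mpr h)]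
    rcases lt_or_gt_of_ne (fun e => h.ne' (σ.injective e) : σ i ≠ σ j) with g | g
    · rw [if_pos g.le, if_neg (not_le.mpr g)]
      have := key _ hi' _ hj' g.le
      linarith
    · rw [if_neg (not_le.mpr g), if_pos g.le]
end

section
/- Let k ≥ 2 be an integer and let α > 0 and β > 0 be reals with α_i ≤ α and β_i C_i ≤ β U_i t_k for all i = 1,…,k−1; assume also α · Σ_{i=1}^{k-1} U_i ≤ 1 and β · Σ_{i=1}^{k-1} U_i ≤ 1. If C_k/t_k ≤ 1 − (α+β) Σ_{i=1}^{k-1} U_i + αβ · Σ_{i=1}^{k-1} U_i · (Σ_{ℓ=i}^{k-1} U_ℓ) (equivalently, C_k/t_k ≤ 1 − (α+β) Σ_{i=1}^{k-1} U_i + 0.5·αβ·((Σ_{i=1}^{k-1} U_i)² + Σ_{i=1}^{k-1} U_i²)), then the k-point last-release test passes. -/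
open Finset

/-- Lemma 3 of the k²Q framework: with uniform bounds α_i ≤ a and β_i C_i ≤ b U_i t_k,
the quadratic utilization condition implies that the k-point last-release test passes. -/
theorem stmt3 (k : ℕ) (hk : 2 ≤ k) (α β U C : ℕ → ℝ)
    (hα : ∀ i ∈ Finset.Icc 1 (k - 1), 0 < α i)
    (hβ : ∀ i ∈ Finset.Icc 1 (k - 1), 0 < β i)
    (hU : ∀ i ∈ Finset.Icc 1 (k - 1), 0 < U i)
    (hC : ∀ i ∈ Finset.Icc 1 (k - 1), 0 ≤ C i)
    (Ck tk : ℝ) (hCk : 0 < Ck) (htk : 0 < tk)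
    (a b : ℝ) (ha : 0 < a) (hb : 0 < b)
    (hαa : ∀ i ∈ Finset.Icc 1 (k - 1), α i ≤ a)
    (hβb : ∀ i ∈ Finset.Icc 1 (k - 1), β i * C i ≤ b * U i * tk)
    (hsum1 : a * ∑ i ∈ Finset.Icc 1 (k - 1), U i ≤ 1)
    (hsum2 : b * ∑ i ∈ Finset.Icc 1 (k - 1), U i ≤ 1)
    (hcond : Ck / tk ≤ 1 - (a + b) * (∑ i ∈ Finset.Icc 1 (k - 1), U i)
      + a * b * ∑ i ∈ Finset.Icc 1 (k - 1), U i * ∑ l ∈ Finset.Icc i (k - 1), U l) :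
    ∀ t : ℕ → ℝ, t k = tk → 0 ≤ t 1 →
      (∀ i, 1 ≤ i → i < k → t i ≤ t (i + 1)) →
      ∃ j ∈ Finset.Icc 1 k,
        Ck + (∑ i ∈ Finset.Icc 1 (k - 1), α i * t i * U i)
          + (∑ i ∈ Finset.Icc 1 (j - 1), β i * C i) ≤ t j := by
  intro t htk' ht1 hmono
  by_contra hcon
  push Not at hcon
  have hpos : ∀ n, n + 1 ≤ k → 0 ≤ t (n + 1) := by
    intro n
    induction n with
    | zero => intro _; simpa using ht1
    | succ m ih =>
      intro h
      exact (ih (by omega)).trans (hmono (m + 1) (by omega) (by omega))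
  have hpos' : ∀ i ∈ Finset.Icc 1 (k - 1), 0 ≤ t i := by
    intro i hi
    rw [Finset.mem_Icc] at hi
    have := hpos (i - 1) (by omega)
    rwa [Nat.sub_add_cancel hi.1] at this
  set P := ∑ i ∈ Finset.Icc 1 (k - 1), U i with hP
  set Q := ∑ i ∈ Finset.Icc 1 (k - 1), U i * ∑ l ∈ Finset.Icc i (k - 1), U l with hQ
  set T := ∑ i ∈ Finset.Icc 1 (k - 1), U i * t i with hT
  set S := ∑ i ∈ Finset.Icc 1 (k - 1), α i * t i * U i with hS
  have hST : S ≤ a * T := by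
    rw [hS, hT, Finset.mul_sum]
    apply Finset.sum_le_sum
    intro i hi
    have h1 := mul_nonneg (hpos' i hi) (hU i hi).le
    have h2 := mul_le_mul_of_nonneg_right (hαa i hi) h1
    linarith
  have hB : ∀ j ∈ Finset.Icc 1 k, ∑ i ∈ Finset.Icc 1 (j - 1), β i * C i
      ≤ b * tk * ∑ i ∈ Finset.Icc 1 (j - 1), U i := by
    intro j hj
    rw [Finset.mem_Icc] at hj
    rw [Finset.mul_sum]
    apply Finset.sum_le_sum
    intro i hi
    rw [Finset.mem_Icc] at hi
    have := hβb i (Finset.mem_Icc.2 ⟨hi.1, by omega⟩)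
    linarith
  have hsplit : ∀ j ∈ Finset.Icc 1 (k - 1), ∑ i ∈ Finset.Icc 1 (j - 1), U i
      + ∑ l ∈ Finset.Icc j (k - 1), U l = P := by
    intro j hj
    rw [Finset.mem_Icc] at hj
    rw [hP, ← Finset.sum_union]
    · congr 1
      ext x
      simp only [Finset.mem_union, Finset.mem_Icc]
      omega
    · rw [Finset.disjoint_left]
      intro x hx hx'
      rw [Finset.mem_Icc] at hx hx'
      omega
  have hk' : k ∈ Finset.Icc 1 k := Finset.mem_Icc.2 ⟨by omega, le_refl _⟩
  have hx : tk < Ck + a * T + b * tk * P := by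
    have h1 := hcon k hk'
    have h2 := hB k hk'
    rw [htk'] at h1
    linarith
  have hTlt : T < (Ck + a * T + b * tk * P) * P - b * tk * Q := by
    have h0 : (Ck + a * T + b * tk * P) * P - b * tk * Q
        = ∑ i ∈ Finset.Icc 1 (k - 1), U i * ((Ck + a * T + b * tk * P)
          - b * tk * ∑ l ∈ Finset.Icc i (k - 1), U l) := by
      generalize Ck + a * T + b * tk * P = x
      rw [hP, hQ, Finset.mul_sum, Finset.mul_sum, ← Finset.sum_sub_distrib]
      apply Finset.sum_congr rfl
      intro i _
      ring
    rw [h0]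
    conv_lhs => rw [hT]
    apply Finset.sum_lt_sum_of_nonempty ⟨1, Finset.mem_Icc.2 ⟨le_refl _, by omega⟩⟩
    intro i hi
    apply mul_lt_mul_of_pos_left _ (hU i hi)
    have hi' : i ∈ Finset.Icc 1 k := by
      rw [Finset.mem_Icc] at hi ⊢
      omega
    have h1 := hcon i hi'
    have h2 := hB i hi'
    have h3 := hsplit i hi
    rw [← h3] 
    linarith
  rw [div_le_iff₀ htk] at hcond
  have h4 := mul_lt_mul_of_pos_left hTlt ha
  have h5 := mul_nonneg (sub_nonneg.2 hx.le) (sub_nonneg.2 hsum1)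
  nlinarith
end

section
/- Let k ≥ 2 be an integer and let α > 0 and β > 0 be reals with α_i ≤ α and β_i C_i ≤ β U_i t_k for all i = 1,…,k−1. If Σ_{i=1}^{k-1} U_i ≤ ((k−1)/k) · (α + β − √((α+β)² − 2αβ(1 − C_k/t_k)·k/(k−1)))/(αβ) and C_k/t_k ≤ 1, then the k-point last-release test passes. -/
open Finset

lemma pair_sum (U : ℕ → ℝ) (n : ℕ) :
    2 * ∑ i ∈ Finset.Icc 1 n, U i * ∑ l ∈ Finset.Icc 1 (i - 1), U l
      = (∑ i ∈ Finset.Icc 1 n, U i) ^ 2 - ∑ i ∈ Finset.Icc 1 n, U i ^ 2 := by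
  induction n with
  | zero => simp
  | succ n ih =>
    rw [Finset.sum_Icc_succ_top (by omega), Finset.sum_Icc_succ_top (by omega),
      Finset.sum_Icc_succ_top (by omega), mul_add, ih]
    simp only [Nat.add_sub_cancel]
    ring

lemma quad (a b c m u D : ℝ) (ha : 0 < a) (hb : 0 < b) (hc : 0 < c) (hm : 0 < m) (hm2 : m ≤ 2)
    (hD0 : 0 ≤ D) (hD2 : D ^ 2 = (a + b) ^ 2 - 2 * a * b * (1 - c) * m)
    (hD : a * b * m * u ≤ a + b - D) :
    a * u < 1 ∧ 0 ≤ a * b * m / 2 * u ^ 2 - (a + b) * u + (1 - c) := by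
  constructor
  · by_contra! h
    have h1 : b * m ≤ a * b * m * u := by nlinarith [mul_pos hb hm]
    have h2 : D ≤ a + b - b * m := by linarith
    have h3 : D ^ 2 ≤ (a + b - b * m) ^ 2 := by gcongr
    have h4 : 0 ≤ (b * m) * (b * (m - 2) - 2 * a * c) := by nlinarith
    have h5 := nonneg_of_mul_nonneg_right h4 (mul_pos hb hm)
    nlinarith [mul_pos ha hc]
  · have h2 : D ≤ a + b - a * b * m * u := by linarith
    have h3 : D ^ 2 ≤ (a + b - a * b * m * u) ^ 2 := by gcongr
    have hp : 0 < 2 * (a * b * m) := by positivity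
    refine nonneg_of_mul_nonneg_right (a := 2 * (a * b * m)) ?_ hp
    nlinarith

/-- Lemma 4 of the k²Q framework: the square-root utilization bound implies that the
k-point last-release test passes. -/
theorem stmt4 (k : ℕ) (hk : 2 ≤ k) (α β U C : ℕ → ℝ)
    (hα : ∀ i ∈ Finset.Icc 1 (k - 1), 0 < α i)
    (hβ : ∀ i ∈ Finset.Icc 1 (k - 1), 0 < β i)
    (hU : ∀ i ∈ Finset.Icc 1 (k - 1), 0 < U i)
    (hC : ∀ i ∈ Finset.Icc 1 (k - 1), 0 ≤ C i)
    (Ck tk : ℝ) (hCk : 0 < Ck) (htk : 0 < tk)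
    (a b : ℝ) (ha : 0 < a) (hb : 0 < b)
    (hαa : ∀ i ∈ Finset.Icc 1 (k - 1), α i ≤ a)
    (hβb : ∀ i ∈ Finset.Icc 1 (k - 1), β i * C i ≤ b * U i * tk)
    (hCktk : Ck / tk ≤ 1)
    (hcond : ∑ i ∈ Finset.Icc 1 (k - 1), U i ≤
      (((k : ℝ) - 1) / k) *
        ((a + b - Real.sqrt ((a + b) ^ 2 - 2 * a * b * (1 - Ck / tk) * ((k : ℝ) / ((k : ℝ) - 1))))
          / (a * b))) :
    ∀ t : ℕ → ℝ, t k = tk → 0 ≤ t 1 →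
      (∀ i, 1 ≤ i → i < k → t i ≤ t (i + 1)) →
      ∃ j ∈ Finset.Icc 1 k,
        Ck + (∑ i ∈ Finset.Icc 1 (k - 1), α i * t i * U i)
          + (∑ i ∈ Finset.Icc 1 (j - 1), β i * C i) ≤ t j := by
  intro t ht ht1 hmono
  by_contra! hcon
  obtain ⟨n, rfl⟩ : ∃ n, k = n + 1 := ⟨k - 1, by omega⟩
  simp only [Nat.add_sub_cancel] at *
  have hn : (1 : ℝ) ≤ n := by exact_mod_cast (by omega : 1 ≤ n)
  have hn0 : (0 : ℝ) < n := by linarith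
  push_cast at hcond
  rw [add_sub_cancel_right] at hcond
  have ht0 : ∀ i, 1 ≤ i → i ≤ n + 1 → 0 ≤ t i := by
    intro i hi
    induction i, hi using Nat.le_induction with
    | base => intro _; exact ht1
    | succ i hi ih => intro h; exact (ih (by omega)).trans (hmono i hi (by omega))
  set S := ∑ i ∈ Finset.Icc 1 n, α i * t i * U i with hS
  set u := ∑ i ∈ Finset.Icc 1 n, U i with hu
  set m : ℝ := ((n : ℝ) + 1) / n with hm
  set c := Ck / tk with hc
  have hc0 : 0 < c := by positivity
  have hm0 : 0 < m := by positivity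
  have hm2 : m ≤ 2 := by rw [hm, div_le_iff₀ hn0]; linarith
  have hinv : (n : ℝ) / (n + 1) = 1 / m := by rw [hm]; field_simp
  have hab : 0 < a * b := by positivity
  have hdisc : 0 ≤ (a + b) ^ 2 - 2 * a * b * (1 - c) * m := by
    have : (1 - c) * m ≤ 2 := by nlinarith
    nlinarith [sq_nonneg (a - b)]
  obtain ⟨hau, hf⟩ := quad a b c m u _ ha hb hc0 hm0 hm2 (Real.sqrt_nonneg _)
    (Real.sq_sqrt hdisc) (by
      rw [hinv, div_mul_div_comm, one_mul, le_div_iff₀ (by positivity)] at hcond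
      linarith)
  have hsum : ∀ j, 1 ≤ j → j ≤ n + 1 →
      ∑ i ∈ Finset.Icc 1 (j - 1), β i * C i ≤ b * tk * ∑ i ∈ Finset.Icc 1 (j - 1), U i := by
    intro j h1 h2
    rw [Finset.mul_sum]
    refine Finset.sum_le_sum fun i hi => ?_
    rw [Finset.mem_Icc] at hi
    have := hβb i (Finset.mem_Icc.2 ⟨hi.1, by omega⟩)
    linarith
  have hk' := hcon (n + 1) (Finset.mem_Icc.2 ⟨by omega, le_rfl⟩)
  have hs' := hsum (n + 1) (by omega) le_rfl
  simp only [Nat.add_sub_cancel] at hk' hs'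
  rw [← hu] at hs'
  rw [ht] at hk'
  have hX : tk * (1 - b * u) < Ck + S := by linarith
  have hSle : S ≤ a * u * (Ck + S)
      + a * b * tk * ∑ i ∈ Finset.Icc 1 n, U i * ∑ l ∈ Finset.Icc 1 (i - 1), U l := by
    have e : a * u * (Ck + S)
      + a * b * tk * ∑ i ∈ Finset.Icc 1 n, U i * ∑ l ∈ Finset.Icc 1 (i - 1), U l
      = ∑ i ∈ Finset.Icc 1 n, (a * U i * (Ck + S + b * tk * ∑ l ∈ Finset.Icc 1 (i - 1), U l)) := by
      rw [hu, Finset.mul_sum, Finset.mul_sum, Finset.sum_mul, ← Finset.sum_add_distrib]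
      exact Finset.sum_congr rfl fun i _ => by ring
    rw [e]
    conv_lhs => rw [hS]
    refine Finset.sum_le_sum fun i hi => ?_
    have hi' := Finset.mem_Icc.1 hi
    have h1 := hcon i (Finset.mem_Icc.2 ⟨hi'.1, by omega⟩)
    have h2 := hsum i hi'.1 (by omega)
    have h3 := ht0 i hi'.1 (by omega)
    have hUi := hU i hi
    calc α i * t i * U i ≤ a * t i * U i := by
          have := hαa i hi
          gcongr
      _ = a * U i * t i := by ring
      _ ≤ _ := by
          refine mul_le_mul_of_nonneg_left ?_ (by positivity)
          linarith
  have hps := pair_sum U n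
  have hcs : u ^ 2 ≤ n * ∑ i ∈ Finset.Icc 1 n, U i ^ 2 := by
    have := sq_sum_le_card_mul_sum_sq (s := Finset.Icc 1 n) (f := U)
    simpa using this
  rw [← hu] at hps
  set Q := ∑ i ∈ Finset.Icc 1 n, U i * ∑ l ∈ Finset.Icc 1 (i - 1), U l
  have hQ : Q ≤ (1 - m / 2) * u ^ 2 := by
    have h1 : u ^ 2 / n ≤ ∑ i ∈ Finset.Icc 1 n, U i ^ 2 := by
      rw [div_le_iff₀ hn0]; linarith
    have h2 : m = 1 + 1 / n := by rw [hm]; field_simp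
    have h3 : u ^ 2 / n = u ^ 2 * (1 / n) := by ring
    rw [h2]
    nlinarith
  have hCk' : Ck = c * tk := by rw [hc]; field_simp
  have h1 : tk * (1 - b * u) * (1 - a * u) < (Ck + S) * (1 - a * u) :=
    mul_lt_mul_of_pos_right hX (by linarith)
  have h2 : a * b * tk * Q ≤ a * b * tk * ((1 - m / 2) * u ^ 2) :=
    mul_le_mul_of_nonneg_left hQ (by positivity)
  have h3 := mul_nonneg htk.le hf
  nlinarith
end

section
/- Let k ≥ 2 be an integer and let α > 0 and β > 0 be reals with α + β ≥ 1, α_i ≤ α and β_i C_i ≤ β U_i t_k for all i = 1,…,k−1. If either (i) k·(α²+β²−1) > (α+β)²−1 and C_k/t_k + Σ_{i=1}^{k-1} U_i ≤ ((k−1)/k) · (α + β − √((α+β)² − 2αβ·k/(k−1)))/(αβ), or (ii) k·(α²+β²−1) ≤ (α+β)²−1 and C_k/t_k + Σ_{i=1}^{k-1} U_i ≤ 1 + (k−1)·((α+β−1) − 0.5(α+β)² + 0.5)/(kαβ), then the k-point last-release test passes. -/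
open Finset

lemma aux_core_i (a b p c S r : ℝ) (ha : 0 < a) (hb : 0 < b) (hp1 : 1 < p) (hp2 : p ≤ 2)
    (hc : 0 < c) (hS : 0 ≤ S) (hr : r ^ 2 = (a + b) ^ 2 - 2 * (a * b * p))
    (hr1 : 1 < r) (hX : a * b * p * (c + S) ≤ a + b - r) :
    a * S < 1 ∧ c ≤ 1 - (a + b) * S + a * b * p * S ^ 2 / 2 := by
  have hab : 0 < a * b := mul_pos ha hb
  have hP : 0 < a * b * p := by positivity
  constructor
  · have h1 : a - b * (p - 1) ≤ r := by
      apply le_of_sq_le_sq _ (by linarith)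
      have : b ^ 2 * (p - 1) ^ 2 ≤ b ^ 2 := by
        have : (p - 1) ^ 2 ≤ 1 := by nlinarith
        nlinarith [sq_nonneg b]
      nlinarith
    have h2 : b * p * (a * S) < b * p * 1 := by nlinarith [mul_pos hP hc]
    exact lt_of_mul_lt_mul_left h2 (by positivity)
  · obtain ⟨X, hXd⟩ : ∃ X, X = c + S := ⟨_, rfl⟩
    obtain ⟨P, hPd⟩ : ∃ P, P = a * b * p := ⟨_, rfl⟩
    rw [← hXd, ← hPd] at hX
    rw [← hPd] at hr hP ⊢
    have hc' : c = X - S := by linarith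
    have h3 : P * S ≤ P * X := by
      apply mul_le_mul_of_nonneg_left _ hP.le
      linarith
    have h1 : 0 ≤ (X - S) * ((a + b - 1) - P * (S + X) / 2) := by
      apply mul_nonneg <;> linarith
    have h2 : 0 ≤ 1 - (a + b) * X + P * X ^ 2 / 2 := by
      have : 0 ≤ P * (1 - (a + b) * X + P * X ^ 2 / 2) := by nlinarith
      exact nonneg_of_mul_nonneg_right this hP
    nlinarith

lemma aux_core_ii (a b p c S : ℝ) (ha : 0 < a) (hb : 0 < b) (hp1 : 1 < p) (hp2 : p ≤ 2)
    (hc : 0 < c) (hX : 2 * (a * b * p) * (c + S) ≤ 2 * (a * b * p) - (a + b - 1) ^ 2) :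
    a * S < 1 ∧ c ≤ 1 - (a + b) * S + a * b * p * S ^ 2 / 2 := by
  have hab : 0 < a * b := mul_pos ha hb
  have hP : 0 < a * b * p := by positivity
  constructor
  · have h2 : (2 * (b * p)) * (a * S) < (2 * (b * p)) * 1 := by
      have h3 : 2 * (b * p) * (a - 1) ≤ (a + b - 1) ^ 2 := by
        rcases le_total a 1 with h | h
        · have : 0 ≤ b * p * (1 - a) := mul_nonneg (by positivity) (by linarith)
          nlinarith [sq_nonneg (a + b - 1)]
        · have : 0 ≤ b * (2 - p) * (a - 1) :=
            mul_nonneg (mul_nonneg hb.le (by linarith)) (by linarith)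
          nlinarith [sq_nonneg (a - 1 - b)]
      nlinarith [mul_pos hP hc]
    exact lt_of_mul_lt_mul_left h2 (by positivity)
  · obtain ⟨P, hPd⟩ : ∃ P, P = a * b * p := ⟨_, rfl⟩
    rw [← hPd] at hX hP ⊢
    have : 0 ≤ P * (1 - (a + b) * S + P * S ^ 2 / 2 - c) := by
      nlinarith [sq_nonneg (P * S - (a + b - 1))]
    have := nonneg_of_mul_nonneg_right this hP
    linarith

lemma aux_sum (U : ℕ → ℝ) (n : ℕ) :
    2 * (∑ i ∈ Finset.Icc 1 n, U i * ∑ j ∈ Finset.Icc 1 (i - 1), U j)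
      + ∑ i ∈ Finset.Icc 1 n, U i ^ 2 = (∑ i ∈ Finset.Icc 1 n, U i) ^ 2 := by
  induction n with
  | zero => simp
  | succ n ih =>
    rw [Finset.sum_Icc_succ_top (by omega), Finset.sum_Icc_succ_top (by omega),
      Finset.sum_Icc_succ_top (by omega), Nat.add_sub_cancel]
    linear_combination ih

/-- Lemma 5 of the k²Q framework: the two-case bound on C_k/t_k + Σ U_i implies that
the k-point last-release test passes, provided α + β ≥ 1. -/
theorem stmt6 (k : ℕ) (hk : 2 ≤ k) (α β U C : ℕ → ℝ)
    (hα : ∀ i ∈ Finset.Icc 1 (k - 1), 0 < α i)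
    (hβ : ∀ i ∈ Finset.Icc 1 (k - 1), 0 < β i)
    (hU : ∀ i ∈ Finset.Icc 1 (k - 1), 0 < U i)
    (hC : ∀ i ∈ Finset.Icc 1 (k - 1), 0 ≤ C i)
    (Ck tk : ℝ) (hCk : 0 < Ck) (htk : 0 < tk)
    (a b : ℝ) (ha : 0 < a) (hb : 0 < b) (hab : 1 ≤ a + b)
    (hαa : ∀ i ∈ Finset.Icc 1 (k - 1), α i ≤ a)
    (hβb : ∀ i ∈ Finset.Icc 1 (k - 1), β i * C i ≤ b * U i * tk)
    (hcond :
      ((k : ℝ) * (a ^ 2 + b ^ 2 - 1) > (a + b) ^ 2 - 1 ∧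
        Ck / tk + (∑ i ∈ Finset.Icc 1 (k - 1), U i) ≤
          (((k : ℝ) - 1) / k) *
            ((a + b - Real.sqrt ((a + b) ^ 2 - 2 * a * b * ((k : ℝ) / ((k : ℝ) - 1))))
              / (a * b)))
      ∨
      ((k : ℝ) * (a ^ 2 + b ^ 2 - 1) ≤ (a + b) ^ 2 - 1 ∧
        Ck / tk + (∑ i ∈ Finset.Icc 1 (k - 1), U i) ≤
          1 + ((k : ℝ) - 1) * ((a + b - 1) - 0.5 * (a + b) ^ 2 + 0.5) / ((k : ℝ) * a * b))) :
    ∀ t : ℕ → ℝ, t k = tk → 0 ≤ t 1 →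
      (∀ i, 1 ≤ i → i < k → t i ≤ t (i + 1)) →
      ∃ j ∈ Finset.Icc 1 k,
        Ck + (∑ i ∈ Finset.Icc 1 (k - 1), α i * t i * U i)
          + (∑ i ∈ Finset.Icc 1 (j - 1), β i * C i) ≤ t j := by
  intro t htk' ht1 hmono
  by_contra hcon
  push Not at hcon
  have hK : (2 : ℝ) ≤ k := by exact_mod_cast hk
  have hK0 : (0 : ℝ) < k := by linarith
  have hn : (0 : ℝ) < (k : ℝ) - 1 := by linarith
  have hnn : (k : ℝ) - 1 ≠ 0 := hn.ne'
  have hab0 : 0 < a * b := mul_pos ha hb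
  obtain ⟨p, hp⟩ : ∃ p : ℝ, p = (k : ℝ) / ((k : ℝ) - 1) := ⟨_, rfl⟩
  have hpk : p * ((k : ℝ) - 1) = k := by rw [hp]; field_simp
  have hp1 : 1 < p := by rw [hp, lt_div_iff₀ hn]; linarith
  have hp2 : p ≤ 2 := by rw [hp, div_le_iff₀ hn]; linarith
  obtain ⟨S, hSd⟩ : ∃ S, S = ∑ i ∈ Finset.Icc 1 (k - 1), U i := ⟨_, rfl⟩
  have hS : 0 ≤ S := by rw [hSd]; exact Finset.sum_nonneg fun i hi => (hU i hi).le
  have hc : 0 < Ck / tk := div_pos hCk htk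
  rw [← hSd] at hcond
  have key : a * S < 1 ∧ Ck / tk ≤ 1 - (a + b) * S + a * b * p * S ^ 2 / 2 := by
    rcases hcond with ⟨h1, h2⟩ | ⟨h1, h2⟩
    · rw [← hp] at h2
      have h3 : 1 < (a + b) ^ 2 - 2 * a * b * p := by
        have : 0 < ((k : ℝ) - 1) * ((a + b) ^ 2 - 2 * a * b * p - 1) := by
          have e : ((k : ℝ) - 1) * ((a + b) ^ 2 - 2 * a * b * p - 1)
            = ((k : ℝ) - 1) * ((a + b) ^ 2 - 1) - 2 * a * b * (p * ((k : ℝ) - 1)) := by ring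
          rw [e, hpk]; linarith
        have := pos_of_mul_pos_right this hn.le
        linarith
      apply aux_core_i a b p _ S (Real.sqrt ((a + b) ^ 2 - 2 * a * b * p)) ha hb hp1 hp2 hc hS
      · rw [Real.sq_sqrt (by linarith)]; ring
      · rw [Real.lt_sqrt (by norm_num)]; linarith
      · have h4 := mul_le_mul_of_nonneg_left h2 (by positivity : 0 ≤ a * b * p)
        refine h4.trans (le_of_eq ?_)
        generalize Real.sqrt ((a + b) ^ 2 - 2 * a * b * p) = r
        rw [hp]; field_simp
    · apply aux_core_ii a b p _ S ha hb hp1 hp2 hc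
      have h4 := mul_le_mul_of_nonneg_left h2 (by positivity : 0 ≤ 2 * (a * b * p))
      refine h4.trans (le_of_eq ?_)
      rw [hp]; field_simp; ring
  obtain ⟨k1, k2⟩ := key
  -- nonnegativity of t
  have htn : ∀ i, 1 ≤ i → i ≤ k → 0 ≤ t i := by
    intro i hi
    induction i, hi using Nat.le_induction with
    | base => intro _; exact ht1
    | succ m hm ih => intro h; exact (ih (by omega)).trans (hmono m hm (by omega))
  obtain ⟨W, hW⟩ : ∃ W, W = Ck + ∑ i ∈ Finset.Icc 1 (k - 1), α i * t i * U i := ⟨_, rfl⟩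
  have hV : ∀ j ∈ Finset.Icc 1 k, t j ≤ W + b * tk * ∑ i ∈ Finset.Icc 1 (j - 1), U i ∧
      t j < W + b * tk * ∑ i ∈ Finset.Icc 1 (j - 1), U i := by
    intro j hj
    have h1 := hcon j hj
    rw [← hW] at h1
    have h2 : ∑ i ∈ Finset.Icc 1 (j - 1), β i * C i ≤
        b * tk * ∑ i ∈ Finset.Icc 1 (j - 1), U i := by
      rw [Finset.mul_sum]
      apply Finset.sum_le_sum
      intro i hi
      rw [Finset.mem_Icc] at hi hj
      have := hβb i (Finset.mem_Icc.2 ⟨hi.1, by omega⟩)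
      linarith
    constructor <;> linarith
  obtain ⟨Q, hQ⟩ : ∃ Q, Q = ∑ i ∈ Finset.Icc 1 (k - 1), U i * ∑ j ∈ Finset.Icc 1 (i - 1), U j :=
    ⟨_, rfl⟩
  have hWle : W ≤ Ck + (a * W * S + a * b * tk * Q) := by
    rw [hW, hQ, hSd, Finset.mul_sum, Finset.mul_sum, ← Finset.sum_add_distrib, ← hW]
    have : ∑ i ∈ Finset.Icc 1 (k - 1), α i * t i * U i ≤ ∑ i ∈ Finset.Icc 1 (k - 1),
        (a * W * U i + a * b * tk * (U i * ∑ j ∈ Finset.Icc 1 (i - 1), U j)) := by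
      apply Finset.sum_le_sum
      intro i hi
      have hi' := Finset.mem_Icc.1 hi
      have e1 : α i * t i * U i ≤ a * t i * U i := by
        have := htn i hi'.1 (by omega)
        have := hαa i hi
        have := (hU i hi).le
        gcongr
      have e2 := (hV i (Finset.mem_Icc.2 ⟨hi'.1, by omega⟩)).1
      have e3 := mul_le_mul_of_nonneg_left e2 (mul_nonneg ha.le (hU i hi).le)
      linarith
    linarith
  have hlast := (hV k (Finset.mem_Icc.2 ⟨by omega, le_rfl⟩)).2
  rw [← hSd, htk'] at hlast
  have hQle : Q ≤ S ^ 2 * (1 - p / 2) := by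
    have h1 := aux_sum U (k - 1)
    have h2 := sq_sum_le_card_mul_sum_sq (s := Finset.Icc 1 (k - 1)) (f := U)
    rw [← hQ, ← hSd] at h1
    rw [← hSd, Nat.card_Icc, Nat.add_sub_cancel, Nat.cast_sub (by omega), Nat.cast_one] at h2
    have h3 : ((k : ℝ) - 1) * Q ≤ ((k : ℝ) - 1) * (S ^ 2 * (1 - p / 2)) := by
      have e : ((k : ℝ) - 1) * (S ^ 2 * (1 - p / 2)) =
        S ^ 2 * (((k : ℝ) - 1) - (p * ((k : ℝ) - 1)) / 2) := by ring
      rw [e, hpk]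
      have h4 : ∑ i ∈ Finset.Icc 1 (k - 1), U i ^ 2 = S ^ 2 - 2 * Q := by linarith
      rw [h4] at h2
      linarith
    exact le_of_mul_le_mul_left h3 hn
  have f1 := mul_lt_mul_of_pos_left hlast (sub_pos.2 k1)
  have f2 := mul_le_mul_of_nonneg_left hQle (by positivity : 0 ≤ a * b * tk)
  have f3 := (div_le_iff₀ htk).1 k2
  linarith
end

section
/- Let k ≥ 2 be an integer and assume Σ_{i=1}^{k-1} α_i U_i < 1. Then for all reals t_1,…,t_{k-1} ≥ 0 satisfying t_j ≤ C_k + Σ_{i=1}^{k-1} α_i t_i U_i + Σ_{i=1}^{j-1} β_i C_i for every j = 1,…,k−1, one has C_k + Σ_{i=1}^{k-1} α_i t_i U_i + Σ_{i=1}^{k-1} β_i C_i ≤ (C_k + Σ_{i=1}^{k-1} β_i C_i − Σ_{i=1}^{k-1} α_i U_i · (Σ_{ℓ=i}^{k-1} β_ℓ C_ℓ))/(1 − Σ_{i=1}^{k-1} α_i U_i). In particular, any value t_k produced by a k-point last-release response time analysis is bounded above by this quantity. -/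
open Finset

/-- Lemma 7 of the k²Q framework: the utilization-based response-time bound.  Any
feasible point of the k-point last-release response time analysis has its objective
bounded by the closed-form quantity. -/
theorem stmt8 (k : ℕ) (hk : 2 ≤ k) (α β U C : ℕ → ℝ)
    (hα : ∀ i ∈ Finset.Icc 1 (k - 1), 0 < α i)
    (hβ : ∀ i ∈ Finset.Icc 1 (k - 1), 0 < β i)
    (hU : ∀ i ∈ Finset.Icc 1 (k - 1), 0 < U i)
    (hC : ∀ i ∈ Finset.Icc 1 (k - 1), 0 ≤ C i)
    (Ck : ℝ) (hCk : 0 < Ck)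
    (hsumU : ∑ i ∈ Finset.Icc 1 (k - 1), α i * U i < 1) :
    ∀ t : ℕ → ℝ,
      (∀ i ∈ Finset.Icc 1 (k - 1), 0 ≤ t i) →
      (∀ j ∈ Finset.Icc 1 (k - 1),
        t j ≤ Ck + (∑ i ∈ Finset.Icc 1 (k - 1), α i * t i * U i)
          + (∑ i ∈ Finset.Icc 1 (j - 1), β i * C i)) →
      Ck + (∑ i ∈ Finset.Icc 1 (k - 1), α i * t i * U i)
        + (∑ i ∈ Finset.Icc 1 (k - 1), β i * C i) ≤
      (Ck + (∑ i ∈ Finset.Icc 1 (k - 1), β i * C i)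
        - ∑ i ∈ Finset.Icc 1 (k - 1),
            α i * U i * ∑ l ∈ Finset.Icc i (k - 1), β l * C l)
        / (1 - ∑ i ∈ Finset.Icc 1 (k - 1), α i * U i) := by
  intro t _ h
  have key : ∑ i ∈ Finset.Icc 1 (k - 1), α i * t i * U i ≤
      ∑ i ∈ Finset.Icc 1 (k - 1), (α i * U i * (Ck + (∑ i ∈ Finset.Icc 1 (k - 1), α i * t i * U i)
        + (∑ i ∈ Finset.Icc 1 (k - 1), β i * C i))
        - α i * U i * ∑ l ∈ Finset.Icc i (k - 1), β l * C l) := by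
    apply Finset.sum_le_sum
    intro j hj
    have h1 := h j hj
    have hp : 0 ≤ α j * U j := (mul_pos (hα j hj) (hU j hj)).le
    have hs : (∑ i ∈ Finset.Icc 1 (j - 1), β i * C i) + ∑ l ∈ Finset.Icc j (k - 1), β l * C l
        = ∑ i ∈ Finset.Icc 1 (k - 1), β i * C i := by
      rw [Finset.mem_Icc] at hj
      rw [← Finset.sum_union]
      · congr 1
        ext x
        simp only [Finset.mem_union, Finset.mem_Icc]
        omega
      · rw [Finset.disjoint_left]
        intro x
        simp only [Finset.mem_Icc]
        omega
    have h2 := mul_le_mul_of_nonneg_left h1 hp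
    rw [← hs]
    linarith
  rw [Finset.sum_sub_distrib, ← Finset.sum_mul] at key
  rw [le_div_iff₀ (by linarith)]
  linarith
end

section
/- Let k ≥ 2 be an integer, assume Σ_{i=1}^{k-1} α_i U_i < 1, and suppose the indices are ordered so that β_1 C_1/(α_1 U_1) ≥ β_2 C_2/(α_2 U_2) ≥ … ≥ β_{k-1} C_{k-1}/(α_{k-1} U_{k-1}). Then for every permutation σ of {1,…,k−1}: (C_k + Σ_{i=1}^{k-1} β_i C_i − Σ_{i=1}^{k-1} α_i U_i · (Σ_{ℓ=i}^{k-1} β_ℓ C_ℓ))/(1 − Σ_{i=1}^{k-1} α_i U_i) ≥ (C_k + Σ_{i=1}^{k-1} β_i C_i − Σ_{i=1}^{k-1} α_{σ(i)} U_{σ(i)} · (Σ_{ℓ=i}^{k-1} β_{σ(ℓ)} C_{σ(ℓ)}))/(1 − Σ_{i=1}^{k-1} α_i U_i). Hence ordering the tasks in non-increasing order of β_i C_i/(α_i U_i) maximizes the response time bound, i.e., it is the worst-case last release time ordering. -/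
open Finset

theorem sym_sum_aux (n : ℕ) (m : ℕ → ℕ → ℝ) (hm : ∀ i j, m i j = m j i) :
    2 * ∑ i ∈ Finset.Icc 1 n, ∑ l ∈ Finset.Icc i n, m i l
      = (∑ i ∈ Finset.Icc 1 n, ∑ l ∈ Finset.Icc 1 n, m i l)
        + ∑ i ∈ Finset.Icc 1 n, m i i := by
  have h1 : ∑ i ∈ Finset.Icc 1 n, ∑ l ∈ Finset.Icc i n, m i l
      = ∑ i ∈ Finset.Icc 1 n, ∑ l ∈ Finset.Icc 1 n, if i ≤ l then m i l else 0 := by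
    refine Finset.sum_congr rfl fun i hi => ?_
    rw [← Finset.sum_filter]
    refine Finset.sum_congr ?_ fun _ _ => rfl
    ext l
    simp only [Finset.mem_Icc, Finset.mem_filter] at *
    omega
  have h2 : ∑ i ∈ Finset.Icc 1 n, ∑ l ∈ Finset.Icc i n, m i l
      = ∑ i ∈ Finset.Icc 1 n, ∑ l ∈ Finset.Icc 1 n, if l ≤ i then m i l else 0 := by
    rw [h1, Finset.sum_comm]
    refine Finset.sum_congr rfl fun i hi => Finset.sum_congr rfl fun l hl => ?_
    rw [hm]
  have h3 : ∑ i ∈ Finset.Icc 1 n, m i i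
      = ∑ i ∈ Finset.Icc 1 n, ∑ l ∈ Finset.Icc 1 n, if i = l then m i l else 0 := by
    refine Finset.sum_congr rfl fun i hi => ?_
    rw [Finset.sum_ite_eq, if_pos hi]
  rw [two_mul]
  nth_rewrite 1 [h1]
  rw [h2, h3]
  simp only [← Finset.sum_add_distrib]
  refine Finset.sum_congr rfl fun i hi => Finset.sum_congr rfl fun l hl => ?_
  rcases lt_trichotomy i l with h | h | h
  · simp [h.le, h.not_ge, h.ne]
  · simp [h]
  · simp [h.le, h.not_ge, h.ne']

/-- Lemma 8 of the k²Q framework: ordering the k−1 higher-priority tasks in a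
non-increasing order of β_i C_i/(α_i U_i) maximizes the response time bound, i.e. it
is the worst-case last release time ordering. -/
theorem stmt9 (k : ℕ) (hk : 2 ≤ k) (α β U C : ℕ → ℝ)
    (hα : ∀ i ∈ Finset.Icc 1 (k - 1), 0 < α i)
    (hβ : ∀ i ∈ Finset.Icc 1 (k - 1), 0 < β i)
    (hU : ∀ i ∈ Finset.Icc 1 (k - 1), 0 < U i)
    (hC : ∀ i ∈ Finset.Icc 1 (k - 1), 0 ≤ C i)
    (Ck : ℝ) (hCk : 0 < Ck)
    (hsumU : ∑ i ∈ Finset.Icc 1 (k - 1), α i * U i < 1)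
    (hord : ∀ i ∈ Finset.Icc 1 (k - 1), ∀ j ∈ Finset.Icc 1 (k - 1), i ≤ j →
      β j * C j / (α j * U j) ≤ β i * C i / (α i * U i)) :
    ∀ σ : Equiv.Perm ℕ, (∀ i ∈ Finset.Icc 1 (k - 1), σ i ∈ Finset.Icc 1 (k - 1)) →
      (Ck + (∑ i ∈ Finset.Icc 1 (k - 1), β i * C i)
        - ∑ i ∈ Finset.Icc 1 (k - 1),
            α (σ i) * U (σ i) * ∑ l ∈ Finset.Icc i (k - 1), β (σ l) * C (σ l))
        / (1 - ∑ i ∈ Finset.Icc 1 (k - 1), α i * U i) ≤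
      (Ck + (∑ i ∈ Finset.Icc 1 (k - 1), β i * C i)
        - ∑ i ∈ Finset.Icc 1 (k - 1),
            α i * U i * ∑ l ∈ Finset.Icc i (k - 1), β l * C l)
        / (1 - ∑ i ∈ Finset.Icc 1 (k - 1), α i * U i) := by
  intro σ hσ
  have hmap : (Finset.Icc 1 (k - 1)).map σ.toEmbedding = Finset.Icc 1 (k - 1) := by
    apply Finset.eq_of_subset_of_card_le
    · intro x hx
      obtain ⟨i, hi, rfl⟩ := Finset.mem_map.1 hx
      exact hσ i hi
    · simp
  have hinv : ∀ f : ℕ → ℝ, ∑ i ∈ Finset.Icc 1 (k - 1), f (σ i)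
      = ∑ i ∈ Finset.Icc 1 (k - 1), f i := by
    intro f
    conv_rhs => rw [← hmap]
    rw [Finset.sum_map]
    rfl
  have hpos : 0 ≤ 1 - ∑ i ∈ Finset.Icc 1 (k - 1), α i * U i := by linarith
  refine div_le_div_of_nonneg_right (sub_le_sub_left ?_ _) hpos
  let m : ℕ → ℕ → ℝ := fun i j => min (α i * U i * (β j * C j)) (α j * U j * (β i * C i))
  have hm : ∀ i j, m i j = m j i := fun i j => min_comm _ _
  have e1 := sym_sum_aux (k - 1) m hm
  have e2 := sym_sum_aux (k - 1) (fun i j => m (σ i) (σ j)) (fun i j => hm _ _)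
  have e3 : ∑ i ∈ Finset.Icc 1 (k - 1), ∑ l ∈ Finset.Icc 1 (k - 1), m (σ i) (σ l)
      = ∑ i ∈ Finset.Icc 1 (k - 1), ∑ l ∈ Finset.Icc 1 (k - 1), m i l := by
    rw [← hinv (fun i => ∑ l ∈ Finset.Icc 1 (k - 1), m i l)]
    exact Finset.sum_congr rfl fun i _ => hinv (fun l => m (σ i) l)
  have e4 := hinv (fun i => m i i)
  have l1 : ∑ i ∈ Finset.Icc 1 (k - 1), α i * U i * ∑ l ∈ Finset.Icc i (k - 1), β l * C l
      = ∑ i ∈ Finset.Icc 1 (k - 1), ∑ l ∈ Finset.Icc i (k - 1), m i l := by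
    refine Finset.sum_congr rfl fun i hi => ?_
    rw [Finset.mul_sum]
    refine Finset.sum_congr rfl fun l hl => ?_
    have hl' : l ∈ Finset.Icc 1 (k - 1) := by
      simp only [Finset.mem_Icc] at *
      omega
    have h := hord i hi l hl' (Finset.mem_Icc.1 hl).1
    rw [div_le_div_iff₀ (mul_pos (hα l hl') (hU l hl')) (mul_pos (hα i hi) (hU i hi))] at h
    exact (min_eq_left (by linarith)).symm
  have l2 : ∑ i ∈ Finset.Icc 1 (k - 1), ∑ l ∈ Finset.Icc i (k - 1), m (σ i) (σ l)
      ≤ ∑ i ∈ Finset.Icc 1 (k - 1),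
            α (σ i) * U (σ i) * ∑ l ∈ Finset.Icc i (k - 1), β (σ l) * C (σ l) := by
    refine Finset.sum_le_sum fun i hi => ?_
    rw [Finset.mul_sum]
    exact Finset.sum_le_sum fun l hl => min_le_left _ _
  linarith
end

section
/- Let k ≥ 2 be an integer, D > 0 and C' > 0 be reals, and for i = 1,…,k−1 let T_i and C_i be reals with 0 < T_i < D and C_i ≥ 0, and set U_i = C_i/T_i. Assume the indices are ordered so that (⌈D/T_1⌉−1)·T_1 ≤ (⌈D/T_2⌉−1)·T_2 ≤ … ≤ (⌈D/T_{k-1}⌉−1)·T_{k-1}. If Σ_{i=1}^{k-1} U_i ≤ 1, Σ_{i=1}^{k-1} C_i ≤ D, and C'/D ≤ 1 − Σ_{i=1}^{k-1} U_i − (Σ_{i=1}^{k-1} C_i)/D + (Σ_{i=1}^{k-1} U_i · (Σ_{ℓ=i}^{k-1} C_ℓ))/D, then there exists a real t with 0 < t ≤ D such that C' + Σ_{i=1}^{k-1} ⌈t/T_i⌉ · C_i ≤ t. -/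
open Finset

/-- Theorem 1 of the paper (arithmetic content): schedulability of an
arbitrary-deadline sporadic task under uniprocessor fixed-priority scheduling via
the quadratic bound above implies the existence of a time-demand point t ∈ (0, D]. -/
theorem stmt10 (k : ℕ) (hk : 2 ≤ k) (D C' : ℝ) (hD : 0 < D) (hC' : 0 < C')
    (T C U : ℕ → ℝ)
    (hT : ∀ i ∈ Finset.Icc 1 (k - 1), 0 < T i ∧ T i < D)
    (hC : ∀ i ∈ Finset.Icc 1 (k - 1), 0 ≤ C i)
    (hU : ∀ i ∈ Finset.Icc 1 (k - 1), U i = C i / T i)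
    (hord : ∀ i ∈ Finset.Icc 1 (k - 1), ∀ j ∈ Finset.Icc 1 (k - 1), i ≤ j →
      ((⌈D / T i⌉ : ℝ) - 1) * T i ≤ ((⌈D / T j⌉ : ℝ) - 1) * T j)
    (hsumU : ∑ i ∈ Finset.Icc 1 (k - 1), U i ≤ 1)
    (hsumC : ∑ i ∈ Finset.Icc 1 (k - 1), C i ≤ D)
    (hcond : C' / D ≤ 1 - (∑ i ∈ Finset.Icc 1 (k - 1), U i)
      - (∑ i ∈ Finset.Icc 1 (k - 1), C i) / D
      + (∑ i ∈ Finset.Icc 1 (k - 1), U i * ∑ l ∈ Finset.Icc i (k - 1), C l) / D) :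
    ∃ t : ℝ, 0 < t ∧ t ≤ D ∧
      C' + (∑ i ∈ Finset.Icc 1 (k - 1), (⌈t / T i⌉ : ℝ) * C i) ≤ t := by
  generalize k - 1 = n at *
  by_contra hcon
  push Not at hcon
  obtain ⟨t, ht⟩ : ∃ t : ℕ → ℝ, ∀ i, t i = ((⌈D / T i⌉ : ℝ) - 1) * T i := ⟨_, fun _ => rfl⟩
  simp only [← ht] at hord
  have hU0 : ∀ i ∈ Finset.Icc 1 n, 0 ≤ U i := fun i hi => by
    rw [hU i hi]; exact div_nonneg (hC i hi) (hT i hi).1.le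
  have htU : ∀ i ∈ Finset.Icc 1 n, t i * U i = ((⌈D / T i⌉ : ℝ) - 1) * C i := fun i hi => by
    rw [ht, hU i hi]
    have := (hT i hi).1.ne'
    field_simp
  have htpos : ∀ i ∈ Finset.Icc 1 n, 0 < t i := fun i hi => by
    obtain ⟨h1, h2⟩ := hT i hi
    rw [ht]
    have : (1 : ℝ) < D / T i := by rw [lt_div_iff₀ h1]; linarith
    have := Int.le_ceil (D / T i)
    exact mul_pos (by linarith) h1
  have htD : ∀ i ∈ Finset.Icc 1 n, t i ≤ D := fun i hi => by
    obtain ⟨h1, h2⟩ := hT i hi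
    have h3 := Int.ceil_lt_add_one (D / T i)
    have h4 : ((⌈D / T i⌉ : ℝ) - 1) ≤ D / T i := by linarith
    rw [ht]
    exact (le_div_iff₀ h1).1 h4
  have hub : ∀ x ≤ D, ∀ i ∈ Finset.Icc 1 n, (⌈x / T i⌉ : ℝ) * C i ≤ t i * U i + C i := by
    intro x hx i hi
    obtain ⟨h1, h2⟩ := hT i hi
    have h3 : (⌈x / T i⌉ : ℝ) ≤ ⌈D / T i⌉ := by
      exact_mod_cast Int.ceil_le_ceil (div_le_div_of_nonneg_right hx h1.le)
    rw [htU i hi]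
    nlinarith [mul_le_mul_of_nonneg_right h3 (hC i hi)]
  have hub2 : ∀ i ∈ Finset.Icc 1 n, ∀ x ≤ t i, (⌈x / T i⌉ : ℝ) * C i ≤ t i * U i := by
    intro i hi x hx
    obtain ⟨h1, h2⟩ := hT i hi
    rw [htU i hi]
    refine mul_le_mul_of_nonneg_right ?_ (hC i hi)
    have : ⌈x / T i⌉ ≤ ⌈D / T i⌉ - 1 := by
      rw [Int.ceil_le, div_le_iff₀ h1]
      push_cast
      rw [← ht]; exact hx
    exact_mod_cast this
  obtain ⟨S, hS⟩ : ∃ S, S = ∑ i ∈ Finset.Icc 1 n, t i * U i := ⟨_, rfl⟩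
  obtain ⟨A, hA⟩ : ∃ A, A = ∑ i ∈ Finset.Icc 1 n, C i := ⟨_, rfl⟩
  obtain ⟨u, hu⟩ : ∃ u, u = ∑ i ∈ Finset.Icc 1 n, U i := ⟨_, rfl⟩
  obtain ⟨Q, hQ⟩ : ∃ Q, Q = ∑ i ∈ Finset.Icc 1 n, U i * ∑ l ∈ Finset.Icc i n, C l := ⟨_, rfl⟩
  rw [← hu, ← hA, ← hQ] at hcond
  rw [← hu] at hsumU
  have hc : C' ≤ D - u * D - A + Q := by
    rw [div_le_iff₀ hD] at hcond
    have e : (1 - u - A / D + Q / D) * D = D - u * D - A + Q := by field_simp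
    linarith
  have hDlt : D < C' + S + A := by
    have h1 := hcon D hD le_rfl
    have h2 := Finset.sum_le_sum (hub D le_rfl)
    rw [Finset.sum_add_distrib, ← hS, ← hA] at h2
    linarith
  have htlt : ∀ j ∈ Finset.Icc 1 n, t j < C' + S + (A - ∑ l ∈ Finset.Icc j n, C l) := by
    intro j hj
    have h1 := hcon (t j) (htpos j hj) (htD j hj)
    have h2 : ∑ i ∈ Finset.Icc 1 n, (⌈t j / T i⌉ : ℝ) * C i
        ≤ ∑ i ∈ Finset.Icc 1 n, (t i * U i + (C i - if j ≤ i then C i else 0)) := by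
      refine Finset.sum_le_sum fun i hi => ?_
      split_ifs with h
      · have := hub2 i hi (t j) (hord j hj i hi h)
        linarith
      · have := hub (t j) (htD j hj) i hi
        linarith
    have h3 : ∑ i ∈ Finset.Icc 1 n, (if j ≤ i then C i else 0) = ∑ l ∈ Finset.Icc j n, C l := by
      rw [← Finset.sum_filter]
      refine Finset.sum_congr ?_ fun _ _ => rfl
      ext i
      simp only [Finset.mem_filter, Finset.mem_Icc] at hj ⊢
      omega
    rw [Finset.sum_add_distrib, Finset.sum_sub_distrib, h3, ← hS, ← hA] at h2
    linarith
  have hsum : ∑ j ∈ Finset.Icc 1 n, (C' + S + (A - ∑ l ∈ Finset.Icc j n, C l)) * U j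
      = (C' + S + A) * u - Q := by
    rw [hu, hQ, Finset.mul_sum, ← Finset.sum_sub_distrib]
    exact Finset.sum_congr rfl fun _ _ => by ring
  rcases hsumU.lt_or_eq with h | h
  · have h1 : S ≤ (C' + S + A) * u - Q := by
      rw [← hsum]
      conv_lhs => rw [hS]
      exact Finset.sum_le_sum fun j hj => mul_le_mul_of_nonneg_right (htlt j hj).le (hU0 j hj)
    nlinarith [mul_pos (sub_pos.2 h) (sub_pos.2 hDlt)]
  · have h1 : S < (C' + S + A) * u - Q := by
      rw [← hsum]
      conv_lhs => rw [hS]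
      refine Finset.sum_lt_sum
        (fun j hj => mul_le_mul_of_nonneg_right (htlt j hj).le (hU0 j hj)) ?_
      obtain ⟨j, hj, hpos⟩ : ∃ j ∈ Finset.Icc 1 n, 0 < U j := by
        by_contra hne
        push Not at hne
        have := Finset.sum_nonpos hne
        linarith
      exact ⟨j, hj, mul_lt_mul_of_pos_right (htlt j hj) hpos⟩
    rw [h] at h1 hc
    linarith
end

section
/- Let k ≥ 2 and h ≥ 1 be integers and C_k > 0 a real; for i = 1,…,k−1 let T_i > 0 and C_i ≥ 0 be reals with U_i = C_i/T_i, indexed so that T_1 ≥ T_2 ≥ … ≥ T_{k-1}, and assume Σ_{i=1}^{k-1} U_i < 1. Define B_h = (h·C_k + Σ_{i=1}^{k-1} C_i − Σ_{i=1}^{k-1} U_i · (Σ_{ℓ=i}^{k-1} C_ℓ))/(1 − Σ_{i=1}^{k-1} U_i). Then there exists a real t with 0 < t ≤ B_h such that h·C_k + Σ_{i=1}^{k-1} ⌈t/T_i⌉ · C_i ≤ t. -/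
open Finset

/-- Lemma 10 of the paper: the finishing time R_{k,h} of the h-th job of task τ_k in
the level-k busy window is at most the closed-form bound B_h, where the k−1
higher-priority tasks are ordered in a non-increasing order of their periods. -/
theorem stmt11 (k h : ℕ) (hk : 2 ≤ k) (hh : 1 ≤ h) (Ck : ℝ) (hCk : 0 < Ck)
    (T C U : ℕ → ℝ)
    (hT : ∀ i ∈ Finset.Icc 1 (k - 1), 0 < T i)
    (hC : ∀ i ∈ Finset.Icc 1 (k - 1), 0 ≤ C i)
    (hU : ∀ i ∈ Finset.Icc 1 (k - 1), U i = C i / T i)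
    (hord : ∀ i ∈ Finset.Icc 1 (k - 1), ∀ j ∈ Finset.Icc 1 (k - 1), i ≤ j →
      T j ≤ T i)
    (hsumU : ∑ i ∈ Finset.Icc 1 (k - 1), U i < 1) :
    ∃ t : ℝ, 0 < t ∧
      t ≤ ((h : ℝ) * Ck + (∑ i ∈ Finset.Icc 1 (k - 1), C i)
          - ∑ i ∈ Finset.Icc 1 (k - 1), U i * ∑ l ∈ Finset.Icc i (k - 1), C l)
          / (1 - ∑ i ∈ Finset.Icc 1 (k - 1), U i) ∧
      (h : ℝ) * Ck + (∑ i ∈ Finset.Icc 1 (k - 1), (⌈t / T i⌉ : ℝ) * C i) ≤ t := by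
  set S := Finset.Icc 1 (k - 1) with hS
  have hU0 : ∀ i ∈ S, 0 ≤ U i := fun i hi => by
    rw [hU i hi]; exact div_nonneg (hC i hi) (hT i hi).le
  have hUT : ∀ i ∈ S, U i * T i = C i := fun i hi => by
    rw [hU i hi]; exact div_mul_cancel₀ _ (hT i hi).ne'
  have hD : 0 < 1 - ∑ i ∈ S, U i := by linarith
  have hhC : 0 < (h : ℝ) * Ck := by
    have : (0 : ℝ) < h := by exact_mod_cast hh
    positivity
  have hC0 : 0 ≤ ∑ i ∈ S, C i := Finset.sum_nonneg hC
  set G : ℝ := ∑ i ∈ S, U i * ∑ l ∈ Finset.Icc i (k - 1), C l with hG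
  have hGle : G ≤ (∑ i ∈ S, U i) * ∑ i ∈ S, C i := by
    rw [Finset.sum_mul]
    refine Finset.sum_le_sum fun i hi => mul_le_mul_of_nonneg_left ?_ (hU0 i hi)
    refine Finset.sum_le_sum_of_subset_of_nonneg ?_ (fun j hj _ => hC j hj)
    exact Finset.Icc_subset_Icc (Finset.mem_Icc.1 hi).1 le_rfl
  set B : ℝ := ((h : ℝ) * Ck + (∑ i ∈ S, C i) - G) / (1 - ∑ i ∈ S, U i) with hB
  have hBD : B * (1 - ∑ i ∈ S, U i) = (h : ℝ) * Ck + (∑ i ∈ S, C i) - G :=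
    div_mul_cancel₀ _ hD.ne'
  have hB0 : 0 < B := by
    apply div_pos _ hD
    nlinarith [mul_nonneg hC0 hD.le]
  by_contra hcon
  push Not at hcon
  let t : ℕ → ℝ := fun i => ((⌈B / T i⌉ : ℝ) - 1) * T i
  have htB : ∀ i ∈ S, t i < B := fun i hi => by
    have h1 := Int.ceil_lt_add_one (B / T i)
    have h2 : (⌈B / T i⌉ : ℝ) - 1 < B / T i := by linarith
    exact (lt_div_iff₀ (hT i hi)).1 h2
  have ht0 : ∀ i ∈ S, 0 ≤ t i := fun i hi => by
    have h1 : 0 < ⌈B / T i⌉ := Int.ceil_pos.2 (div_pos hB0 (hT i hi))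
    have h2 : (1 : ℝ) ≤ (⌈B / T i⌉ : ℝ) := by exact_mod_cast h1
    exact mul_nonneg (by linarith) (hT i hi).le
  have htU : ∀ i ∈ S, U i * t i = (⌈B / T i⌉ : ℝ) * C i - C i := fun i hi => by
    have := hUT i hi
    simp only [t]
    linear_combination ((⌈B / T i⌉ : ℝ) - 1) * this
  let F : ℕ → ℝ := fun j => ∑ i ∈ S, if t j ≤ t i then C i else 0
  set Y : ℝ := (h : ℝ) * Ck + ∑ i ∈ S, U i * t i + ∑ i ∈ S, C i with hY
  have hBY : B < Y := by
    have h1 := hcon B hB0 le_rfl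
    have h2 : ∑ i ∈ S, U i * t i = ∑ i ∈ S, (⌈B / T i⌉ : ℝ) * C i - ∑ i ∈ S, C i := by
      rw [← Finset.sum_sub_distrib]; exact Finset.sum_congr rfl htU
    linarith
  have hF : ∀ j ∈ S, t j ≤ Y - F j := fun j hj => by
    have hFle : F j ≤ ∑ i ∈ S, C i := by
      refine Finset.sum_le_sum fun i hi => ?_
      split_ifs
      · exact le_rfl
      · exact hC i hi
    rcases (ht0 j hj).eq_or_lt with h0 | h0
    · have : 0 ≤ ∑ i ∈ S, U i * t i :=
        Finset.sum_nonneg fun i hi => mul_nonneg (hU0 i hi) (ht0 i hi)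
      linarith
    · have h1 := hcon (t j) h0 (htB j hj).le
      have h2 : ∑ i ∈ S, (⌈t j / T i⌉ : ℝ) * C i ≤
          ∑ i ∈ S, (U i * t i + C i - if t j ≤ t i then C i else 0) := by
        refine Finset.sum_le_sum fun i hi => ?_
        rw [htU i hi]
        split_ifs with hle
        · have h3 : ⌈t j / T i⌉ ≤ ⌈B / T i⌉ - 1 := by
            rw [Int.ceil_le, div_le_iff₀ (hT i hi)]
            push_cast
            exact hle
          have h4 : (⌈t j / T i⌉ : ℝ) ≤ (⌈B / T i⌉ : ℝ) - 1 := by exact_mod_cast h3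
          nlinarith [mul_le_mul_of_nonneg_right h4 (hC i hi)]
        · have h3 : ⌈t j / T i⌉ ≤ ⌈B / T i⌉ :=
            Int.ceil_le_ceil (div_le_div_of_nonneg_right (htB j hj).le (hT i hi).le)
          have h4 : (⌈t j / T i⌉ : ℝ) ≤ (⌈B / T i⌉ : ℝ) := by exact_mod_cast h3
          nlinarith [mul_le_mul_of_nonneg_right h4 (hC i hi)]
      rw [Finset.sum_sub_distrib, Finset.sum_add_distrib] at h2
      change _ ≤ _ - F j at h2
      linarith
  have hX : ∑ j ∈ S, U j * t j ≤ (∑ j ∈ S, U j) * Y - ∑ j ∈ S, U j * F j := by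
    rw [Finset.sum_mul, ← Finset.sum_sub_distrib]
    refine Finset.sum_le_sum fun j hj => ?_
    nlinarith [mul_le_mul_of_nonneg_left (hF j hj) (hU0 j hj)]
  have hGF : G ≤ ∑ j ∈ S, U j * F j := by
    let f : ℕ → ℕ → ℝ := fun j i => if t j ≤ t i then U j * C i else 0
    let g : ℕ → ℕ → ℝ := fun j i => if j ≤ i then U j * C i else 0
    have hf : ∑ j ∈ S, U j * F j = ∑ j ∈ S, ∑ i ∈ S, f j i := by
      refine Finset.sum_congr rfl fun j _ => ?_
      simp only [F, f, Finset.mul_sum, mul_ite, mul_zero]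
    have hg : G = ∑ j ∈ S, ∑ i ∈ S, g j i := by
      refine Finset.sum_congr rfl fun j hj => ?_
      simp only [g, Finset.mul_sum]
      rw [← Finset.sum_filter]
      refine Finset.sum_congr ?_ fun _ _ => rfl
      ext i
      simp only [hS, Finset.mem_filter, Finset.mem_Icc] at hj ⊢
      omega
    have key : ∀ j ∈ S, ∀ i ∈ S, j < i → U j * C i ≤ f j i + f i j := by
      intro j hj i hi hji
      have hT' := hord j hj i hi hji.le
      have e1 : U j * C i ≤ U i * C j := by
        rw [← hUT i hi, ← hUT j hj]
        nlinarith [mul_le_mul_of_nonneg_left hT' (mul_nonneg (hU0 i hi) (hU0 j hj))]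
      have e2 := mul_nonneg (hU0 j hj) (hC i hi)
      simp only [f]
      split_ifs with a b b
      · linarith
      · linarith
      · linarith
      · exact absurd (le_of_not_ge a) b
    have hp : ∑ j ∈ S, ∑ i ∈ S, (g j i + g i j) ≤ ∑ j ∈ S, ∑ i ∈ S, (f j i + f i j) := by
      refine Finset.sum_le_sum fun j hj => Finset.sum_le_sum fun i hi => ?_
      rcases lt_trichotomy j i with hl | hl | hl
      · have := key j hj i hi hl
        simp only [g, if_pos hl.le, if_neg (not_le.2 hl)]
        linarith
      · subst hl
        simp [f, g]
      · have := key i hi j hj hl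
        simp only [g, if_pos hl.le, if_neg (not_le.2 hl)]
        linarith
    simp only [Finset.sum_add_distrib] at hp
    rw [Finset.sum_comm (f := fun j i => g i j), Finset.sum_comm (f := fun j i => f i j)] at hp
    rw [hf, hg]
    linarith
  have : Y * (1 - ∑ i ∈ S, U i) ≤ B * (1 - ∑ i ∈ S, U i) := by
    rw [hBD]; nlinarith
  have := le_of_mul_le_mul_right this hD
  linarith
end

section
/- Let k ≥ 2 be an integer; for i = 1,…,k−1 let T_i > 0 and C_i ≥ 0 be reals with U_i = C_i/T_i, indexed so that T_1 ≥ T_2 ≥ … ≥ T_{k-1}; let T_k > 0 and C_k > 0 with U_k = C_k/T_k, and assume Σ_{i=1}^{k} U_i ≤ 1. Define R = (C_k + Σ_{i=1}^{k-1} C_i − Σ_{i=1}^{k-1} U_i · (Σ_{ℓ=i}^{k-1} C_ℓ))/(1 − Σ_{i=1}^{k-1} U_i). Then for every integer h ≥ 1 there exists a real t with 0 < t ≤ (h−1)·T_k + R such that h·C_k + Σ_{i=1}^{k-1} ⌈t/T_i⌉ · C_i ≤ t. -/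
open Finset

/-- Theorem 2 of the paper: the worst-case response time of task τ_k is at most R,
where the k−1 higher-priority tasks are ordered in a non-increasing order of their
periods. -/
theorem stmt12 (k : ℕ) (hk : 2 ≤ k)
    (T C U : ℕ → ℝ)
    (hT : ∀ i ∈ Finset.Icc 1 (k - 1), 0 < T i)
    (hC : ∀ i ∈ Finset.Icc 1 (k - 1), 0 ≤ C i)
    (hU : ∀ i ∈ Finset.Icc 1 (k - 1), U i = C i / T i)
    (hord : ∀ i ∈ Finset.Icc 1 (k - 1), ∀ j ∈ Finset.Icc 1 (k - 1), i ≤ j →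
      T j ≤ T i)
    (Tk Ck Uk : ℝ) (hTk : 0 < Tk) (hCk : 0 < Ck) (hUk : Uk = Ck / Tk)
    (hsumU : (∑ i ∈ Finset.Icc 1 (k - 1), U i) + Uk ≤ 1) :
    ∀ h : ℕ, 1 ≤ h →
      ∃ t : ℝ, 0 < t ∧
        t ≤ ((h : ℝ) - 1) * Tk +
          (Ck + (∑ i ∈ Finset.Icc 1 (k - 1), C i)
            - ∑ i ∈ Finset.Icc 1 (k - 1), U i * ∑ l ∈ Finset.Icc i (k - 1), C l)
            / (1 - ∑ i ∈ Finset.Icc 1 (k - 1), U i) ∧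
        (h : ℝ) * Ck + (∑ i ∈ Finset.Icc 1 (k - 1), (⌈t / T i⌉ : ℝ) * C i) ≤ t := by
  intro h hh
  set s := Finset.Icc 1 (k - 1) with hs
  have hU0 : ∀ i ∈ s, 0 ≤ U i := fun i hi => by
    rw [hU i hi]; exact div_nonneg (hC i hi) (hT i hi).le
  have hUk0 : 0 < Uk := by rw [hUk]; positivity
  have hUkT : Uk * Tk = Ck := by rw [hUk]; field_simp
  have hh' : (1 : ℝ) ≤ h := by exact_mod_cast hh
  set u := ∑ i ∈ s, U i with hu
  have hu1 : 0 < 1 - u := by linarith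
  -- rewrite the inner sums
  have hin : ∀ i ∈ s, ∑ l ∈ Finset.Icc i (k - 1), C l
      = (∑ l ∈ s, C l) - ∑ l ∈ s, (if l < i then C l else 0) := by
    intro i hi
    rw [← Finset.sum_sub_distrib]
    have h1 : Finset.Icc i (k-1) = s.filter (fun l => ¬ l < i) := by
      ext l
      simp only [hs, Finset.mem_Icc, Finset.mem_filter] at hi ⊢
      omega
    rw [h1, Finset.sum_filter]
    refine Finset.sum_congr rfl fun l _ => ?_
    by_cases hl : l < i <;> simp [hl]
  set Q := ∑ i ∈ s, U i * ∑ l ∈ s, (if l < i then C l else 0) with hQ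
  set c := ∑ l ∈ s, C l with hc
  have hc0 : 0 ≤ c := Finset.sum_nonneg hC
  have hQ0 : 0 ≤ Q := by
    refine Finset.sum_nonneg fun i hi => mul_nonneg (hU0 i hi) (Finset.sum_nonneg fun l hl => ?_)
    split_ifs
    · exact hC l hl
    · exact le_rfl
  have hP : ∑ i ∈ s, U i * ∑ l ∈ Finset.Icc i (k - 1), C l = u * c - Q := by
    rw [hu, hQ, Finset.sum_mul, ← Finset.sum_sub_distrib]
    refine Finset.sum_congr rfl fun i hi => ?_
    rw [hin i hi]; ring
  rw [hP]
  set X := ((h : ℝ) - 1) * Tk + (Ck + c - (u * c - Q)) / (1 - u) with hX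
  have hXm : X * (1 - u) = ((h : ℝ) - 1) * Tk * (1 - u) + (Ck + c - (u * c - Q)) := by
    rw [hX]; field_simp
  have hXge : h * Ck + c * (1 - u) + Q ≤ X * (1 - u) := by
    have : ((h : ℝ) - 1) * Tk * Uk ≤ ((h : ℝ) - 1) * Tk * (1 - u) :=
      mul_le_mul_of_nonneg_left (by linarith) (mul_nonneg (by linarith) hTk.le)
    nlinarith
  have hD : 0 < (h : ℝ) * Ck := by positivity
  have hX0 : 0 < X := by
    have h2 : 0 < X * (1 - u) := by
      have := mul_nonneg hc0 hu1.le
      linarith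
    exact pos_of_mul_pos_left h2 hu1.le
  by_contra hcon
  push Not at hcon
  let g : ℕ → ℝ := fun i => (⌈X / T i⌉ : ℝ) - 1
  let τ : ℕ → ℝ := fun i => g i * T i
  have hg0 : ∀ i ∈ s, 0 ≤ g i := fun i hi => by
    have h3 : 0 < ⌈X / T i⌉ := Int.ceil_pos.mpr (div_pos hX0 (hT i hi))
    have h4 : (1 : ℝ) ≤ (⌈X / T i⌉ : ℝ) := by exact_mod_cast h3
    simp only [g]; linarith
  have hτ0 : ∀ i ∈ s, 0 ≤ τ i := fun i hi => mul_nonneg (hg0 i hi) (hT i hi).le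
  have hτX : ∀ i ∈ s, τ i ≤ X := fun i hi => by
    have := Int.ceil_lt_add_one (X / T i)
    have h4 : g i ≤ X / T i := by simp only [g]; linarith
    exact (le_div_iff₀ (hT i hi)).mp h4
  have hgC : ∀ i ∈ s, g i * C i = U i * τ i := fun i hi => by
    have := (hT i hi).ne'
    rw [hU i hi]; simp only [τ]; field_simp
  set S := ∑ l ∈ s, U l * τ l with hS
  have hS0 : 0 ≤ S := Finset.sum_nonneg fun l hl => mul_nonneg (hU0 l hl) (hτ0 l hl)
  have hB0 : ∀ j, 0 ≤ ∑ l ∈ s, (if τ l < τ j then C l else 0) := fun j => by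
    refine Finset.sum_nonneg fun l hl => ?_
    split_ifs
    · exact hC l hl
    · exact le_rfl
  have key : ∀ j ∈ s, τ j ≤ h * Ck + S + ∑ l ∈ s, (if τ l < τ j then C l else 0) := by
    intro j hj
    rcases (hτ0 j hj).eq_or_lt with h0 | h0
    · have := hB0 j
      rw [← h0] at this ⊢
      linarith
    · have h5 := hcon (τ j) h0 (hτX j hj)
      have h6 : ∑ i ∈ s, (⌈τ j / T i⌉ : ℝ) * C i
          ≤ S + ∑ l ∈ s, (if τ l < τ j then C l else 0) := by
        rw [hS, ← Finset.sum_add_distrib]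
        refine Finset.sum_le_sum fun l hl => ?_
        rw [← hgC l hl]
        split_ifs with hlt
        · have h7 : ⌈τ j / T l⌉ ≤ ⌈X / T l⌉ :=
            Int.ceil_le_ceil (div_le_div_of_nonneg_right (hτX j hj) (hT l hl).le)
          have h8 : (⌈τ j / T l⌉ : ℝ) ≤ g l + 1 := by
            simp only [g]; rw [sub_add_cancel]; exact_mod_cast h7
          nlinarith [mul_le_mul_of_nonneg_right h8 (hC l hl)]
        · have h7 : ⌈τ j / T l⌉ ≤ ⌈X / T l⌉ - 1 := by
            rw [Int.ceil_le, div_le_iff₀ (hT l hl)]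
            push_cast
            exact not_lt.mp hlt
          have h8 : (⌈τ j / T l⌉ : ℝ) ≤ g l := by
            simp only [g]; exact_mod_cast h7
          rw [add_zero]
          exact mul_le_mul_of_nonneg_right h8 (hC l hl)
      linarith
  have keyX : X < h * Ck + S + c := by
    have h5 := hcon X hX0 le_rfl
    have h6 : ∑ i ∈ s, (⌈X / T i⌉ : ℝ) * C i = S + c := by
      rw [hS, hc, ← Finset.sum_add_distrib]
      refine Finset.sum_congr rfl fun l hl => ?_
      rw [← hgC l hl]; simp only [g]; ring
    linarith
  set Q' := ∑ i ∈ s, U i * ∑ l ∈ s, (if τ l < τ i then C l else 0) with hQ'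
  have hSle : S ≤ u * (h * Ck + S) + Q' := by
    conv_lhs => rw [hS]
    rw [hu, hQ', Finset.sum_mul, ← Finset.sum_add_distrib]
    refine Finset.sum_le_sum fun j hj => ?_
    rw [← mul_add]
    exact mul_le_mul_of_nonneg_left (key j hj) (hU0 j hj)
  have hQQ : Q' ≤ Q := by
    have e1 : Q' = ∑ i ∈ s, ∑ l ∈ s, (if τ l < τ i then U i * C l else 0) := by
      simp only [hQ', Finset.mul_sum, mul_ite, mul_zero]
    have e2 : Q = ∑ i ∈ s, ∑ l ∈ s, (if l < i then U i * C l else 0) := by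
      simp only [hQ, Finset.mul_sum, mul_ite, mul_zero]
    have e1' := e1
    have e2' := e2
    rw [Finset.sum_comm] at e1' e2'
    have : Q' + Q' ≤ Q + Q := by
      conv_lhs => rw [e1]; arg 2; rw [← e1, e1']
      conv_rhs => rw [e2]; arg 2; rw [← e2, e2']
      simp only [← Finset.sum_add_distrib]
      refine Finset.sum_le_sum fun i hi => Finset.sum_le_sum fun l hl => ?_
      have p1 := mul_nonneg (hU0 i hi) (hC l hl)
      have p2 := mul_nonneg (hU0 l hl) (hC i hi)
      have cmp : ∀ a ∈ s, ∀ b ∈ s, a ≤ b → U a * C b ≤ U b * C a := by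
        intro a ha b hb hab
        rw [hU a ha, hU b hb, div_mul_eq_mul_div, div_mul_eq_mul_div, mul_comm (C b)]
        exact div_le_div_of_nonneg_left (mul_nonneg (hC a ha) (hC b hb)) (hT b hb)
          (hord a ha b hb hab)
      rcases lt_trichotomy l i with hli | hli | hli
      · have := cmp l hl i hi hli.le
        rw [if_pos hli, if_neg hli.le.not_gt]
        split_ifs <;> linarith
      · subst hli; simp
      · have := cmp i hi l hl hli.le
        rw [if_pos hli, if_neg hli.le.not_gt]
        split_ifs <;> linarith
    linarith
  have := mul_lt_mul_of_pos_right keyX hu1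
  nlinarith
end

section
/- Let k ≥ 2 be an integer; for i = 1,…,k−1 let T_i > 0 and C_i ≥ 0 be reals with U_i = C_i/T_i, indexed so that T_1 ≥ T_2 ≥ … ≥ T_{k-1}; let T_k > 0, C_k > 0, U_k = C_k/T_k, and D > 0. If Σ_{i=1}^{k} U_i ≤ 1 and C_k/D ≤ 1 − Σ_{i=1}^{k-1} U_i − (Σ_{i=1}^{k-1} C_i)/D + (Σ_{i=1}^{k-1} U_i · (Σ_{ℓ=i}^{k-1} C_ℓ))/D, then for every integer h ≥ 1 there exists a real t with 0 < t ≤ (h−1)·T_k + D such that h·C_k + Σ_{i=1}^{k-1} ⌈t/T_i⌉ · C_i ≤ t. -/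
open Finset

/-- Corollary 1 of the paper: the quadratic schedulability condition implies that
every job of task τ_k meets a relative deadline of D, where the k−1 higher-priority
tasks are ordered in a non-increasing order of their periods. -/
theorem stmt13 (k : ℕ) (hk : 2 ≤ k)
    (T C U : ℕ → ℝ)
    (hT : ∀ i ∈ Finset.Icc 1 (k - 1), 0 < T i)
    (hC : ∀ i ∈ Finset.Icc 1 (k - 1), 0 ≤ C i)
    (hU : ∀ i ∈ Finset.Icc 1 (k - 1), U i = C i / T i)
    (hord : ∀ i ∈ Finset.Icc 1 (k - 1), ∀ j ∈ Finset.Icc 1 (k - 1), i ≤ j →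
      T j ≤ T i)
    (Tk Ck Uk D : ℝ) (hTk : 0 < Tk) (hCk : 0 < Ck) (hUk : Uk = Ck / Tk) (hD : 0 < D)
    (hsumU : (∑ i ∈ Finset.Icc 1 (k - 1), U i) + Uk ≤ 1)
    (hcond : Ck / D ≤ 1 - (∑ i ∈ Finset.Icc 1 (k - 1), U i)
      - (∑ i ∈ Finset.Icc 1 (k - 1), C i) / D
      + (∑ i ∈ Finset.Icc 1 (k - 1), U i * ∑ l ∈ Finset.Icc i (k - 1), C l) / D) :
    ∀ h : ℕ, 1 ≤ h →
      ∃ t : ℝ, 0 < t ∧ t ≤ ((h : ℝ) - 1) * Tk + D ∧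
        (h : ℝ) * Ck + (∑ i ∈ Finset.Icc 1 (k - 1), (⌈t / T i⌉ : ℝ) * C i) ≤ t := by
  intro h hh
  have hh' : (1:ℝ) ≤ h := by exact_mod_cast hh
  generalize hS : Finset.Icc 1 (k - 1) = S at *
  have hinner : ∀ i ∈ S, ∑ l ∈ Finset.Icc i (k - 1), C l
      = (∑ l ∈ S, C l) - ∑ l ∈ S, (if l < i then C l else 0) := by
    intro i hi
    rw [← Finset.sum_sub_distrib]
    have : Finset.Icc i (k - 1) = S.filter (fun l => ¬ l < i) := by
      ext l
      rw [← hS] at hi ⊢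
      simp only [Finset.mem_Icc, Finset.mem_filter] at *
      omega
    rw [this, Finset.sum_filter]
    apply Finset.sum_congr rfl
    intro l _
    split_ifs <;> simp_all
  have hUnn : ∀ i ∈ S, 0 ≤ U i := fun i hi => by
    rw [hU i hi]; exact div_nonneg (hC i hi) (hT i hi).le
  have hCU : ∀ i ∈ S, C i = U i * T i := fun i hi => by
    rw [hU i hi, div_mul_cancel₀ _ (hT i hi).ne']
  have hUkpos : 0 < Uk := by rw [hUk]; positivity
  have hCkU : Ck = Uk * Tk := by rw [hUk, div_mul_cancel₀ _ hTk.ne']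
  set SU := ∑ i ∈ S, U i with hSU
  set SC := ∑ i ∈ S, C i with hSC
  set Q := ∑ j ∈ S, U j * ∑ i ∈ S, (if i < j then C i else 0) with hQ
  have hsum : ∑ i ∈ S, U i * ∑ l ∈ Finset.Icc i (k - 1), C l = SU * SC - Q := by
    rw [hQ, hSU, Finset.sum_mul, ← Finset.sum_sub_distrib]
    apply Finset.sum_congr rfl
    intro i hi
    rw [hinner i hi]; ring
  rw [hsum] at hcond
  have hcond2 : Ck ≤ D * (1 - SU) - SC + (SU * SC - Q) := by
    have := mul_le_mul_of_nonneg_right hcond hD.le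
    have e : (1 - SU - SC / D + (SU * SC - Q) / D) * D
        = D * (1 - SU) - SC + (SU * SC - Q) := by field_simp
    rw [e, div_mul_cancel₀ _ hD.ne'] at this
    exact this
  set L := ((h:ℝ) - 1) * Tk + D with hL
  have hLpos : 0 < L := by
    have : 0 ≤ ((h:ℝ) - 1) * Tk := mul_nonneg (by linarith) hTk.le
    linarith
  have hmain : h * Ck ≤ L * (1 - SU) - SC + (SU * SC - Q) := by
    have h1 : ((h:ℝ) - 1) * Tk * Uk ≤ ((h:ℝ) - 1) * Tk * (1 - SU) :=
      mul_le_mul_of_nonneg_left (by linarith) (mul_nonneg (by linarith) hTk.le)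
    have h2 : ((h:ℝ) - 1) * Ck = ((h:ℝ) - 1) * Tk * Uk := by rw [hCkU]; ring
    rw [hL]; linarith
  by_contra hcon
  push Not at hcon
  let t : ℕ → ℝ := fun i => (⌊L / T i⌋ : ℝ) * T i
  have ht0 : ∀ i ∈ S, 0 ≤ t i := fun i hi => by
    have : (0:ℤ) ≤ ⌊L / T i⌋ := Int.floor_nonneg.2 (div_nonneg hLpos.le (hT i hi).le)
    exact mul_nonneg (by exact_mod_cast this) (hT i hi).le
  have htL : ∀ i ∈ S, t i ≤ L := fun i hi => by
    have := Int.floor_le (L / T i)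
    exact (le_div_iff₀ (hT i hi)).1 this
  set A := h * Ck + ∑ i ∈ S, t i * U i with hA
  have hceil : ∀ i ∈ S, ∀ s ≤ L, (⌈s / T i⌉ : ℝ) ≤ (⌊L / T i⌋ : ℝ) + 1 := by
    intro i hi s hs
    have h1 : ⌈s / T i⌉ ≤ ⌊L / T i⌋ + 1 := by
      rw [Int.ceil_le]
      push_cast
      exact (div_le_div_of_nonneg_right hs (hT i hi).le).trans (Int.lt_floor_add_one _).le
    exact_mod_cast h1
  have htU : ∀ i ∈ S, t i * U i = (⌊L / T i⌋ : ℝ) * C i := fun i hi => by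
    rw [hCU i hi]; ring
  have hAL : L < A + SC := by
    refine (hcon L hLpos le_rfl).trans_le ?_
    rw [hA, hSC, add_assoc, ← Finset.sum_add_distrib]
    gcongr with i hi
    rw [htU i hi]
    have := mul_le_mul_of_nonneg_right (hceil i hi L le_rfl) (hC i hi)
    linarith
  have hAj : ∀ j ∈ S, t j ≤ A + ∑ i ∈ S, (if t i < t j then C i else 0) := by
    intro j hj
    rcases (ht0 j hj).eq_or_lt with h0 | h0
    · rw [← h0, hA]
      have h1 : 0 ≤ ∑ i ∈ S, t i * U i :=
        Finset.sum_nonneg fun i hi => mul_nonneg (ht0 i hi) (hUnn i hi)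
      have h2 : 0 ≤ ∑ i ∈ S, (if t i < 0 then C i else 0) :=
        Finset.sum_nonneg fun i hi => by
          split_ifs
          · exact hC i hi
          · exact le_rfl
      have h3 : 0 < h * Ck := by positivity
      linarith
    · refine (hcon (t j) h0 (htL j hj)).le.trans ?_
      rw [hA, add_assoc, ← Finset.sum_add_distrib]
      gcongr with i hi
      rw [htU i hi]
      split_ifs with hij
      · have := mul_le_mul_of_nonneg_right (hceil i hi (t j) (htL j hj)) (hC i hi)
        linarith
      · rw [add_zero]
        apply mul_le_mul_of_nonneg_right _ (hC i hi)
        have h1 : ⌈t j / T i⌉ ≤ ⌊L / T i⌋ := by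
          rw [Int.ceil_le, div_le_iff₀ (hT i hi)]
          exact not_lt.1 hij
        exact_mod_cast h1
  set P := ∑ j ∈ S, U j * ∑ i ∈ S, (if t i < t j then C i else 0) with hP
  have hAP : A ≤ h * Ck + (SU * A + P) := by
    have : ∑ i ∈ S, t i * U i ≤ SU * A + P := by
      rw [hP, hSU, Finset.sum_mul, ← Finset.sum_add_distrib]
      apply Finset.sum_le_sum
      intro j hj
      have := mul_le_mul_of_nonneg_left (hAj j hj) (hUnn j hj)
      linarith
    linarith
  have hPQ : P ≤ Q := by
    have sym : ∀ f : ℕ → ℕ → ℝ, 2 * ∑ j ∈ S, ∑ i ∈ S, f i j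
        = ∑ j ∈ S, ∑ i ∈ S, (f i j + f j i) := by
      intro f
      simp only [Finset.sum_add_distrib]
      rw [Finset.sum_comm (f := fun j i => f j i)]
      ring
    rw [hP, hQ]
    simp only [Finset.mul_sum]
    have h1 := sym (fun i j => U j * (if t i < t j then C i else 0))
    have h2 := sym (fun i j => U j * (if i < j then C i else 0))
    have key : ∀ i ∈ S, ∀ j ∈ S, i < j → U i * C j ≤ U j * C i := by
      intro i hi j hj hij
      rw [hCU i hi, hCU j hj]
      have := mul_le_mul_of_nonneg_left (hord i hi j hj hij.le)
        (mul_nonneg (hUnn i hi) (hUnn j hj))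
      linarith
    have h3 : ∑ j ∈ S, ∑ i ∈ S, (U j * (if t i < t j then C i else 0)
          + U i * (if t j < t i then C j else 0))
        ≤ ∑ j ∈ S, ∑ i ∈ S, (U j * (if i < j then C i else 0)
          + U i * (if j < i then C j else 0)) := by
      apply Finset.sum_le_sum
      intro j hj
      apply Finset.sum_le_sum
      intro i hi
      have n1 := mul_nonneg (hUnn i hi) (hC j hj)
      have n2 := mul_nonneg (hUnn j hj) (hC i hi)
      rcases lt_trichotomy i j with hij | hij | hij
      · have := key i hi j hj hij
        rw [if_pos hij, if_neg hij.asymm]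
        split_ifs <;> linarith
      · subst hij; simp
      · have := key j hj i hi hij
        rw [if_pos hij, if_neg hij.asymm]
        split_ifs <;> linarith
    linarith
  have hfin : (L - SC) * (1 - SU) < A * (1 - SU) :=
    mul_lt_mul_of_pos_right (by linarith) (by linarith)
  linarith
end

section
/- Let k ≥ 2 be an integer; for i = 1,…,k−1 let T_i > 0 and C_i ≥ 0 be reals with U_i = C_i/T_i and T_i ≤ T_k (rate-monotonic priority ordering); let T_k > 0, C_k > 0, U_k = C_k/T_k, D > 0, and set β = T_k/D. If Σ_{i=1}^{k} U_i ≤ 1 and Σ_{i=1}^{k-1} U_i ≤ ((k−1)/(β·k)) · (1 + β − √(1 + β² + 2β²·U_k·k/(k−1))), then for every integer h ≥ 1 there exists a real t with 0 < t ≤ (h−1)·T_k + D such that h·C_k + Σ_{i=1}^{k-1} ⌈t/T_i⌉ · C_i ≤ t, where the k−1 higher-priority tasks in the sums Σ_{ℓ=i}^{k-1} are ordered in a non-increasing order of their periods. -/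
open Finset

lemma aux_pairs (I : Finset ℕ) (U t : ℕ → ℝ) (hU : ∀ i ∈ I, 0 ≤ U i) :
    (∑ i ∈ I, U i) ^ 2 + ∑ i ∈ I, U i ^ 2 ≤
      2 * ∑ l ∈ I, ∑ i ∈ I, U l * U i * (if t i ≤ t l then (1 : ℝ) else 0) := by
  have e1 : (∑ i ∈ I, U i) ^ 2 = ∑ l ∈ I, ∑ i ∈ I, U l * U i := by
    rw [sq, Finset.sum_mul_sum]
  have e2 : ∑ i ∈ I, U i ^ 2 = ∑ l ∈ I, ∑ i ∈ I, U l * U i * (if l = i then (1 : ℝ) else 0) := by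
    refine Finset.sum_congr rfl fun l hl => ?_
    simp [hl, sq]
  have e3 : ∑ l ∈ I, ∑ i ∈ I, U l * U i * (if t i ≤ t l then (1 : ℝ) else 0)
      = ∑ l ∈ I, ∑ i ∈ I, U l * U i * (if t l ≤ t i then (1 : ℝ) else 0) := by
    rw [Finset.sum_comm]
    refine Finset.sum_congr rfl fun l hl => Finset.sum_congr rfl fun i hi => ?_
    rw [mul_comm (U i)]
  rw [two_mul]
  nth_rewrite 2 [e3]
  rw [e1, e2, ← Finset.sum_add_distrib, ← Finset.sum_add_distrib]
  refine Finset.sum_le_sum fun l hl => ?_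
  rw [← Finset.sum_add_distrib, ← Finset.sum_add_distrib]
  refine Finset.sum_le_sum fun i hi => ?_
  have h0 : 0 ≤ U l * U i := mul_nonneg (hU l hl) (hU i hi)
  by_cases h : l = i
  · subst h; simp
  · rcases le_total (t i) (t l) with h1 | h1
    · simp only [h, h1, if_true, if_false]
      split_ifs <;> linarith
    · simp only [h, h1, if_true, if_false]
      split_ifs <;> linarith

lemma aux_quad (k S β Uk : ℝ) (hk : 1 < k) (hβ : 0 < β) (hUk : 0 ≤ Uk)
    (hcond : S ≤ ((k - 1) / (β * k)) *
        (1 + β - Real.sqrt (1 + β ^ 2 + 2 * β ^ 2 * Uk * (k / (k - 1))))) :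
    β * Uk + β * (S - S ^ 2 * (k / (k - 1)) / 2) ≤ 1 - S := by
  have hk1 : 0 < k - 1 := by linarith
  have hk0 : 0 < k := by linarith
  have hc1 : 1 ≤ k / (k - 1) := by rw [le_div_iff₀ hk1]; linarith
  have e : (k - 1) / (β * k) = 1 / (β * (k / (k - 1))) := by field_simp
  rw [e] at hcond
  generalize k / (k - 1) = c at *
  have hc : 0 < c := by linarith
  have hx : 0 ≤ 1 + β ^ 2 + 2 * β ^ 2 * Uk * c := by positivity
  have hr := Real.sqrt_nonneg (1 + β ^ 2 + 2 * β ^ 2 * Uk * c)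
  have hr2 := Real.sq_sqrt hx
  generalize Real.sqrt (1 + β ^ 2 + 2 * β ^ 2 * Uk * c) = r at *
  have hbc : 0 < β * c := by positivity
  rw [one_div_mul_eq_div, le_div_iff₀ hbc] at hcond
  have h1 : r ^ 2 ≤ (1 + β - S * (β * c)) ^ 2 := by
    apply pow_le_pow_left₀ hr; linarith
  rw [hr2] at h1
  have h2 : 0 ≤ (2 * (β * c)) * (1 - S - (β * Uk + β * (S - S ^ 2 * c / 2))) := by
    nlinarith [mul_nonneg hβ.le (sub_nonneg.2 hc1)]
  have := nonneg_of_mul_nonneg_right h2 (by positivity)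
  linarith

/-- Corollary 2, first bound, of the paper: the square-root utilization bound for
rate-monotonic scheduling with arbitrary deadline D (β = T_k/D) implies that task τ_k
meets its relative deadline D. -/
theorem stmt14 (k : ℕ) (hk : 2 ≤ k)
    (T C U : ℕ → ℝ)
    (hT : ∀ i ∈ Finset.Icc 1 (k - 1), 0 < T i)
    (hC : ∀ i ∈ Finset.Icc 1 (k - 1), 0 ≤ C i)
    (hU : ∀ i ∈ Finset.Icc 1 (k - 1), U i = C i / T i)
    (Tk Ck Uk D : ℝ) (hTk : 0 < Tk) (hCk : 0 < Ck) (hUk : Uk = Ck / Tk) (hD : 0 < D)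
    (hRM : ∀ i ∈ Finset.Icc 1 (k - 1), T i ≤ Tk)
    (hord : ∀ i ∈ Finset.Icc 1 (k - 1), ∀ j ∈ Finset.Icc 1 (k - 1), i ≤ j →
      T j ≤ T i)
    (β : ℝ) (hβ : β = Tk / D)
    (hsumU : (∑ i ∈ Finset.Icc 1 (k - 1), U i) + Uk ≤ 1)
    (hcond : ∑ i ∈ Finset.Icc 1 (k - 1), U i ≤
      (((k : ℝ) - 1) / (β * k)) *
        (1 + β - Real.sqrt (1 + β ^ 2 + 2 * β ^ 2 * Uk * ((k : ℝ) / ((k : ℝ) - 1))))) :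
    ∀ h : ℕ, 1 ≤ h →
      ∃ t : ℝ, 0 < t ∧ t ≤ ((h : ℝ) - 1) * Tk + D ∧
        (h : ℝ) * Ck + (∑ i ∈ Finset.Icc 1 (k - 1), (⌈t / T i⌉ : ℝ) * C i) ≤ t := by
  intro h hh
  set I := Finset.Icc 1 (k - 1) with hI
  have hh1 : (1 : ℝ) ≤ h := by exact_mod_cast hh
  have hk1 : (1 : ℝ) < k := by exact_mod_cast (by omega : 1 < k)
  have hβ0 : 0 < β := by rw [hβ]; positivity
  have hUk0 : 0 < Uk := by rw [hUk]; positivity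
  have hU0 : ∀ i ∈ I, 0 ≤ U i := fun i hi => by
    rw [hU i hi]; exact div_nonneg (hC i hi) (hT i hi).le
  have hCU : ∀ i ∈ I, C i = U i * T i := fun i hi => by
    rw [hU i hi, div_mul_cancel₀ _ (hT i hi).ne']
  set S := ∑ i ∈ I, U i with hS
  have hquad := aux_quad k S β Uk hk1 hβ0 hUk0.le hcond
  have hcs : S ^ 2 * ((k : ℝ) / ((k : ℝ) - 1)) ≤ S ^ 2 + ∑ i ∈ I, U i ^ 2 := by
    have h1 : S ^ 2 ≤ (I.card : ℝ) * ∑ i ∈ I, U i ^ 2 := sq_sum_le_card_mul_sum_sq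
    have h2 : (I.card : ℝ) = (k : ℝ) - 1 := by
      rw [hI, Nat.card_Icc]
      have : k - 1 + 1 - 1 = k - 1 := by omega
      rw [this, Nat.cast_sub (by omega)]; simp
    rw [h2] at h1
    have hp : 0 < (k : ℝ) - 1 := by linarith
    rw [← mul_div_assoc, div_le_iff₀ hp]
    nlinarith
  by_contra hcon
  push Not at hcon
  set E := ((h : ℝ) - 1) * Tk + D with hE
  have hE0 : 0 < E := by
    have : 0 ≤ ((h : ℝ) - 1) * Tk := mul_nonneg (by linarith) hTk.le
    linarith
  set t : ℕ → ℝ := fun i => ((⌈E / T i⌉ : ℝ) - 1) * T i with ht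
  have htE : ∀ i ∈ I, t i < E := fun i hi => by
    have := Int.ceil_lt_add_one (E / T i)
    rw [← lt_div_iff₀ (hT i hi)]; linarith
  have ht0 : ∀ i ∈ I, 0 ≤ t i := fun i hi => by
    have h1 : 0 < ⌈E / T i⌉ := Int.ceil_pos.2 (div_pos hE0 (hT i hi))
    have h2 : (1 : ℝ) ≤ (⌈E / T i⌉ : ℝ) := by exact_mod_cast h1
    exact mul_nonneg (by linarith) (hT i hi).le
  have hceil : ∀ x, x ≤ E → ∀ i ∈ I, (⌈x / T i⌉ : ℝ) * C i ≤
      U i * t i + C i * (if t i < x then (1 : ℝ) else 0) := fun x hx i hi => by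
    have hTi := hT i hi
    have e : U i * t i = ((⌈E / T i⌉ : ℝ) - 1) * C i := by
      rw [hCU i hi]; simp only [ht]; ring
    rw [e]
    split_ifs with hlt
    · have : (⌈x / T i⌉ : ℝ) ≤ ⌈E / T i⌉ := by
        exact_mod_cast Int.ceil_mono (div_le_div_of_nonneg_right hx hTi.le)
      nlinarith [mul_le_mul_of_nonneg_right this (hC i hi)]
    · have h1 : x / T i ≤ ((⌈E / T i⌉ - 1 : ℤ) : ℝ) := by
        rw [div_le_iff₀ hTi]; push_cast; exact not_lt.1 hlt
      have h2 : (⌈x / T i⌉ : ℝ) ≤ (⌈E / T i⌉ : ℝ) - 1 := by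
        exact_mod_cast Int.ceil_le.2 h1
      nlinarith [mul_le_mul_of_nonneg_right h2 (hC i hi)]
  set X := (h : ℝ) * Ck + ∑ i ∈ I, U i * t i with hX
  have hX0 : 0 ≤ X := add_nonneg (mul_nonneg (by linarith) hCk.le)
    (Finset.sum_nonneg fun i hi => mul_nonneg (hU0 i hi) (ht0 i hi))
  have hW : ∀ x, 0 < x → x ≤ E → x < X + ∑ i ∈ I, C i * (if t i < x then (1 : ℝ) else 0) := by
    intro x hx0 hxE
    have h1 := hcon x hx0 hxE
    have h2 := Finset.sum_le_sum (hceil x hxE)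
    rw [Finset.sum_add_distrib] at h2
    linarith
  have hEX : E < X + ∑ i ∈ I, C i := by
    have := hW E hE0 le_rfl
    have h2 : ∑ i ∈ I, C i * (if t i < E then (1 : ℝ) else 0) = ∑ i ∈ I, C i :=
      Finset.sum_congr rfl fun i hi => by simp [htE i hi]
    linarith
  have htX : ∀ j ∈ I, t j ≤ X + ∑ i ∈ I, C i * (if t i < t j then (1 : ℝ) else 0) := by
    intro j hj
    rcases (ht0 j hj).eq_or_lt with h0 | h0
    · rw [← h0]
      refine add_nonneg hX0 (Finset.sum_nonneg fun i hi => mul_nonneg (hC i hi) ?_)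
      split_ifs <;> norm_num
    · exact (hW _ h0 (htE j hj).le).le
  -- bound on X
  have hX1 : X ≤ (h : ℝ) * Ck + X * S +
      ∑ j ∈ I, U j * ∑ i ∈ I, C i * (if t i < t j then (1 : ℝ) else 0) := by
    have h1 := Finset.sum_le_sum fun j hj => mul_le_mul_of_nonneg_left (htX j hj) (hU0 j hj)
    have h2 : ∑ j ∈ I, U j * (X + ∑ i ∈ I, C i * (if t i < t j then (1 : ℝ) else 0)) =
        X * S + ∑ j ∈ I, U j * ∑ i ∈ I, C i * (if t i < t j then (1 : ℝ) else 0) := by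
      simp only [mul_add, Finset.sum_add_distrib]
      rw [← Finset.sum_mul, mul_comm]
    linarith
  have hsw : ∑ j ∈ I, U j * ∑ i ∈ I, C i * (if t i < t j then (1 : ℝ) else 0) =
      S * ∑ i ∈ I, C i - ∑ l ∈ I, C l * ∑ i ∈ I, U i * (if t i ≤ t l then (1 : ℝ) else 0) := by
    have e1 : S * ∑ i ∈ I, C i = ∑ l ∈ I, ∑ i ∈ I, C l * U i := by
      rw [mul_comm, hS, Finset.sum_mul_sum]
    rw [e1, ← Finset.sum_sub_distrib]
    simp only [Finset.mul_sum]
    rw [Finset.sum_comm]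
    refine Finset.sum_congr rfl fun l hl => ?_
    rw [← Finset.sum_sub_distrib]
    refine Finset.sum_congr rfl fun i hi => ?_
    rcases lt_or_ge (t l) (t i) with hl | hl
    · simp [hl, not_le.2 hl]; ring
    · simp [hl, not_lt.2 hl]
  have hmain : ∑ l ∈ I, C l - ∑ l ∈ I, C l * ∑ i ∈ I, U i * (if t i ≤ t l then (1 : ℝ) else 0)
      ≤ Tk * (S - ∑ l ∈ I, ∑ i ∈ I, U l * U i * (if t i ≤ t l then (1 : ℝ) else 0)) := by
    rw [hS, ← Finset.sum_sub_distrib, ← Finset.sum_sub_distrib, Finset.mul_sum]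
    refine Finset.sum_le_sum fun l hl => ?_
    simp only [mul_assoc]
    rw [← Finset.mul_sum, hCU l hl]
    have h1 : ∑ i ∈ I, U i * (if t i ≤ t l then (1 : ℝ) else 0) ≤ S := by
      refine Finset.sum_le_sum fun i hi => ?_
      have := hU0 i hi
      split_ifs <;> linarith
    generalize ∑ i ∈ I, U i * (if t i ≤ t l then (1 : ℝ) else 0) = q at *
    have h2 : 0 ≤ U l * (1 - q) := mul_nonneg (hU0 l hl) (by linarith)
    nlinarith [mul_le_mul_of_nonneg_right (hRM l hl) h2]
  have hp := aux_pairs I U t hU0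
  rw [hsw] at hX1
  generalize ∑ l ∈ I, C l * ∑ i ∈ I, U i * (if t i ≤ t l then (1 : ℝ) else 0) = Q at *
  generalize ∑ l ∈ I, ∑ i ∈ I, U l * U i * (if t i ≤ t l then (1 : ℝ) else 0) = P at *
  generalize ∑ i ∈ I, C i = CC at *
  have hS1 : 0 < 1 - S := by linarith
  have hfin : E * (1 - S) < (h : ℝ) * Ck + (CC - Q) := by
    nlinarith [mul_lt_mul_of_pos_right hEX hS1]
  have hPle : Tk * (S - P) ≤ Tk * (S - S ^ 2 * ((k : ℝ) / ((k : ℝ) - 1)) / 2) :=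
    mul_le_mul_of_nonneg_left (by linarith) hTk.le
  generalize (S - S ^ 2 * ((k : ℝ) / ((k : ℝ) - 1)) / 2) = G at *
  have hDq := mul_le_mul_of_nonneg_left hquad hD.le
  have hDβ : D * β = Tk := by rw [hβ]; field_simp
  have hCkU : Ck = Tk * Uk := by rw [hUk]; field_simp
  have hDq2 : Ck + Tk * G ≤ D * (1 - S) := by
    rw [hCkU, ← hDβ]; linarith
  have hlast : ((h : ℝ) - 1) * Ck ≤ ((h : ℝ) - 1) * Tk * (1 - S) := by
    rw [hCkU, mul_assoc]
    refine mul_le_mul_of_nonneg_left (mul_le_mul_of_nonneg_left (by linarith) hTk.le) (by linarith)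
  rw [hE] at hfin
  linarith
end

section
/- Let M ≥ 1 and k ≥ 2 be integers; for i = 1,…,k let T_i > 0 and C_i ≥ 0 be reals with C_k > 0, U_i = C_i/T_i, and T_i ≤ T_k for all i < k (rate-monotonic priority ordering). Set U^max = max_{1 ≤ j ≤ k} U_j and assume Σ_{i=1}^{k-1} U_i ≤ M. If U^max ≤ 1 − (2/M) · Σ_{i=1}^{k-1} U_i + (0.5/M²) · ((Σ_{i=1}^{k-1} U_i)² + Σ_{i=1}^{k-1} U_i²), then for every real y ≥ 0 and all reals ω_1,…,ω_{k-1} with 0 ≤ ω_i ≤ T_i there exists a real t with 0 < t ≤ T_k + y such that U^max · (T_k + y) + (1/M) · Σ_{i=1}^{k-1} (ω_i·U_i + ⌈(t − ω_i)/T_i⌉ · C_i) ≤ t. -/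
open Finset

lemma pair_sum_aux (s : Finset ℕ) (U τ : ℕ → ℝ) (hU : ∀ i ∈ s, 0 ≤ U i) :
    2 * (∑ j ∈ s, U j * ∑ i ∈ s, (if τ i < τ j then U i else 0)) + ∑ i ∈ s, U i ^ 2
      ≤ (∑ i ∈ s, U i) ^ 2 := by
  have e1 : (∑ j ∈ s, U j * ∑ i ∈ s, (if τ i < τ j then U i else 0))
      = ∑ j ∈ s, ∑ i ∈ s, (if τ i < τ j then U j * U i else 0) := by
    simp only [Finset.mul_sum, mul_ite, mul_zero]
  have e2 : (∑ j ∈ s, U j * ∑ i ∈ s, (if τ i < τ j then U i else 0))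
      = ∑ j ∈ s, ∑ i ∈ s, (if τ j < τ i then U j * U i else 0) := by
    rw [e1, Finset.sum_comm]
    simp only [mul_comm]
  have e3 : ∑ i ∈ s, U i ^ 2 = ∑ j ∈ s, ∑ i ∈ s, (if j = i then U j * U i else 0) := by
    refine Finset.sum_congr rfl fun j hj => ?_
    rw [Finset.sum_ite_eq, if_pos hj, sq]
  rw [two_mul]
  nth_rewrite 1 [e1]
  rw [e2, e3, sq, Finset.sum_mul_sum, ← Finset.sum_add_distrib, ← Finset.sum_add_distrib]
  refine Finset.sum_le_sum fun j hj => ?_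
  rw [← Finset.sum_add_distrib, ← Finset.sum_add_distrib]
  refine Finset.sum_le_sum fun i hi => ?_
  have h := mul_nonneg (hU j hj) (hU i hi)
  rcases lt_trichotomy (τ i) (τ j) with h1 | h1 | h1
  · have h2 : j ≠ i := by rintro rfl; exact lt_irrefl _ h1
    simp [h1, h2, not_lt.mpr h1.le]
  · simp only [h1, lt_irrefl, if_false]
    split_ifs <;> linarith
  · have h2 : j ≠ i := by rintro rfl; exact lt_irrefl _ h1
    simp [h1, h2, not_lt.mpr h1.le]

/-- Theorem 3, first condition, of the paper: the quadratic utilization test for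
global rate-monotonic scheduling on M processors implies the forced-forwarding
schedulability condition for task τ_k. -/
theorem stmt16 (M k : ℕ) (hM : 1 ≤ M) (hk : 2 ≤ k)
    (T C U : ℕ → ℝ)
    (hT : ∀ i ∈ Finset.Icc 1 k, 0 < T i)
    (hC : ∀ i ∈ Finset.Icc 1 k, 0 ≤ C i)
    (hCk : 0 < C k)
    (hU : ∀ i ∈ Finset.Icc 1 k, U i = C i / T i)
    (hRM : ∀ i ∈ Finset.Icc 1 (k - 1), T i ≤ T k)
    (Umax : ℝ)
    (hUmax1 : ∀ j ∈ Finset.Icc 1 k, U j ≤ Umax)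
    (hUmax2 : ∃ j ∈ Finset.Icc 1 k, Umax = U j)
    (hsumU : ∑ i ∈ Finset.Icc 1 (k - 1), U i ≤ (M : ℝ))
    (hcond : Umax ≤ 1 - (2 / (M : ℝ)) * (∑ i ∈ Finset.Icc 1 (k - 1), U i)
      + (0.5 / (M : ℝ) ^ 2) *
        ((∑ i ∈ Finset.Icc 1 (k - 1), U i) ^ 2 + ∑ i ∈ Finset.Icc 1 (k - 1), U i ^ 2)) :
    ∀ y : ℝ, 0 ≤ y → ∀ ω : ℕ → ℝ,
      (∀ i ∈ Finset.Icc 1 (k - 1), 0 ≤ ω i ∧ ω i ≤ T i) →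
      ∃ t : ℝ, 0 < t ∧ t ≤ T k + y ∧
        Umax * (T k + y) +
          (1 / (M : ℝ)) *
            (∑ i ∈ Finset.Icc 1 (k - 1), (ω i * U i + (⌈(t - ω i) / T i⌉ : ℝ) * C i))
          ≤ t := by
  intro y hy ω hω
  by_contra hcon
  push Not at hcon
  have hsub : ∀ i ∈ Finset.Icc 1 (k - 1), i ∈ Finset.Icc 1 k := by
    intro i hi
    simp only [Finset.mem_Icc] at *
    omega
  have hkm : k ∈ Finset.Icc 1 k := by simp only [Finset.mem_Icc]; omega
  generalize hs : Finset.Icc 1 (k - 1) = s at *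
  have hTk := hT k hkm
  have hL0 : 0 < T k + y := by linarith
  have hLT : ∀ i ∈ s, T i ≤ T k + y := fun i hi => by linarith [hRM i hi]
  generalize T k + y = L at *
  have hm : (0 : ℝ) < M := by exact_mod_cast hM
  generalize (M : ℝ) = m at *
  have hUm0 : 0 < Umax := by
    have h1 := hUmax1 k hkm
    rw [hU k hkm] at h1
    exact lt_of_lt_of_le (div_pos hCk hTk) h1
  have hT' : ∀ i ∈ s, 0 < T i := fun i hi => hT i (hsub i hi)
  have hU0 : ∀ i ∈ s, 0 ≤ U i := fun i hi => by
    rw [hU i (hsub i hi)]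
    exact div_nonneg (hC i (hsub i hi)) (hT' i hi).le
  have hCU : ∀ i ∈ s, C i = U i * T i := fun i hi => by
    rw [hU i (hsub i hi)]
    field_simp [(hT' i hi).ne']
  set τ : ℕ → ℝ := fun i => ω i + ((⌈(L - ω i) / T i⌉ : ℝ) - 1) * T i with hτ
  have hτL : ∀ i ∈ s, τ i < L := fun i hi => by
    have h1 := Int.ceil_lt_add_one ((L - ω i) / T i)
    have h2 : (⌈(L - ω i) / T i⌉ : ℝ) - 1 < (L - ω i) / T i := by linarith
    rw [lt_div_iff₀ (hT' i hi)] at h2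
    simp only [hτ]
    linarith
  have hτL2 : ∀ i ∈ s, L ≤ τ i + T i := fun i hi => by
    have h1 := Int.le_ceil ((L - ω i) / T i)
    rw [div_le_iff₀ (hT' i hi)] at h1
    simp only [hτ]
    linarith
  have hτ0 : ∀ i ∈ s, 0 ≤ τ i := fun i hi => by linarith [hτL2 i hi, hLT i hi]
  have hfL : ∀ i ∈ s, ∀ t, t ≤ L → ω i * U i + (⌈(t - ω i) / T i⌉ : ℝ) * C i
      ≤ U i * τ i + U i * L := fun i hi t ht => by
    have h1 : (⌈(t - ω i) / T i⌉ : ℝ) ≤ (⌈(L - ω i) / T i⌉ : ℝ) := by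
      have h0 := (hT' i hi).le
      exact_mod_cast Int.ceil_le_ceil (by gcongr)
    have h2 := mul_le_mul_of_nonneg_right h1 (mul_nonneg (hU0 i hi) (hT' i hi).le)
    have h3 := mul_le_mul_of_nonneg_left (hLT i hi) (hU0 i hi)
    rw [hCU i hi]
    simp only [hτ]
    linarith
  have hft : ∀ i ∈ s, ∀ t, t ≤ τ i → ω i * U i + (⌈(t - ω i) / T i⌉ : ℝ) * C i
      ≤ U i * τ i := fun i hi t ht => by
    have h1 : (⌈(t - ω i) / T i⌉ : ℝ) ≤ (⌈(L - ω i) / T i⌉ : ℝ) - 1 := by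
      have : ⌈(t - ω i) / T i⌉ ≤ ⌈(L - ω i) / T i⌉ - 1 := by
        rw [Int.ceil_le, div_le_iff₀ (hT' i hi)]
        push_cast
        simp only [hτ] at ht
        linarith
      exact_mod_cast this
    have h2 := mul_le_mul_of_nonneg_right h1 (mul_nonneg (hU0 i hi) (hT' i hi).le)
    rw [hCU i hi]
    simp only [hτ]
    linarith
  clear_value τ
  have hP := pair_sum_aux s U τ hU0
  set P := ∑ j ∈ s, U j * ∑ i ∈ s, (if τ i < τ j then U i else 0) with hPd
  set W := ∑ i ∈ s, U i * τ i with hW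
  have hW0 : 0 ≤ W := Finset.sum_nonneg fun i hi => mul_nonneg (hU0 i hi) (hτ0 i hi)
  have hP0 : 0 ≤ P := Finset.sum_nonneg fun j hj => mul_nonneg (hU0 j hj)
    (Finset.sum_nonneg fun i hi => by split_ifs; exacts [hU0 i hi, le_rfl])
  have h1 : ∀ j ∈ s, m * τ j ≤ m * (Umax * L) + W
      + L * ∑ i ∈ s, (if τ i < τ j then U i else 0) := by
    intro j hj
    have hn : 0 ≤ ∑ i ∈ s, (if τ i < τ j then U i else 0) :=
      Finset.sum_nonneg fun i hi => by split_ifs; exacts [hU0 i hi, le_rfl]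
    rcases (hτ0 j hj).eq_or_lt with h0 | h0
    · rw [← h0] at hn ⊢
      rw [mul_zero]
      positivity
    · have h2 := hcon (τ j) h0 (hτL j hj).le
      have h3 : ∑ i ∈ s, (ω i * U i + (⌈(τ j - ω i) / T i⌉ : ℝ) * C i)
          ≤ W + L * ∑ i ∈ s, (if τ i < τ j then U i else 0) := by
        rw [hW, Finset.mul_sum, ← Finset.sum_add_distrib]
        refine Finset.sum_le_sum fun i hi => ?_
        split_ifs with hlt
        · have := hfL i hi (τ j) (hτL j hj).le
          linarith
        · have := hft i hi (τ j) (not_lt.mp hlt)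
          linarith
      have h4 := mul_lt_mul_of_pos_left h2 hm
      rw [mul_add, ← mul_assoc m (1 / m), mul_one_div_cancel hm.ne', one_mul] at h4
      linarith
  set S := ∑ i ∈ s, U i with hS
  set Q := ∑ i ∈ s, U i ^ 2 with hQ
  have h2 : m * L < m * (Umax * L) + W + L * S := by
    have h2 := hcon L hL0 le_rfl
    have h3 : ∑ i ∈ s, (ω i * U i + (⌈(L - ω i) / T i⌉ : ℝ) * C i) ≤ W + L * S := by
      rw [hW, hS, Finset.mul_sum, ← Finset.sum_add_distrib]
      refine Finset.sum_le_sum fun i hi => ?_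
      have := hfL i hi L le_rfl
      linarith
    have h4 := mul_lt_mul_of_pos_left h2 hm
    rw [mul_add, ← mul_assoc m (1 / m), mul_one_div_cancel hm.ne', one_mul] at h4
    linarith
  have h3 : m * W ≤ (m * (Umax * L) + W) * S + L * P := by
    rw [hW, Finset.mul_sum, ← hW, hS, hPd, Finset.mul_sum, Finset.mul_sum,
      ← Finset.sum_add_distrib]
    refine Finset.sum_le_sum fun j hj => ?_
    have := mul_le_mul_of_nonneg_left (h1 j hj) (hU0 j hj)
    linarith
  have hc : m ^ 2 * Umax ≤ m ^ 2 - 2 * m * S + (S ^ 2 + Q) / 2 := by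
    have h4 := mul_le_mul_of_nonneg_left hcond (sq_nonneg m)
    have h5 : m ^ 2 * (1 - 2 / m * S + 0.5 / m ^ 2 * (S ^ 2 + Q))
        = m ^ 2 - 2 * m * S + (S ^ 2 + Q) / 2 := by
      field_simp
      ring
    linarith
  rcases hsumU.eq_or_lt with he | hlt
  · have : 0 < m ^ 2 * Umax := by positivity
    rw [← he] at this hc
    nlinarith
  · have h4 := mul_lt_mul_of_pos_left h2 (sub_pos.mpr hlt)
    have h5 : L * (m - S) ^ 2 < L * (m ^ 2 * Umax + P) := by nlinarith
    have h6 := lt_of_mul_lt_mul_left h5 hL0.le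
    nlinarith
end

section
/- Let M ≥ 1 and k ≥ 2 be integers; for i = 1,…,k let T_i > 0 and C_i ≥ 0 be reals with C_k > 0, U_i = C_i/T_i, and T_i ≤ T_k for all i < k (rate-monotonic priority ordering). Set U^max = max_{1 ≤ j ≤ k} U_j. If (1/M) · Σ_{j=1}^{k-1} U_j ≤ ((k−1)/k) · (2 − √(2 + 2·U^max·k/(k−1))), then for every real y ≥ 0 and all reals ω_1,…,ω_{k-1} with 0 ≤ ω_i ≤ T_i there exists a real t with 0 < t ≤ T_k + y such that U^max · (T_k + y) + (1/M) · Σ_{i=1}^{k-1} (ω_i·U_i + ⌈(t − ω_i)/T_i⌉ · C_i) ≤ t. -/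
open Finset

lemma pair_sum_le (I : Finset ℕ) (v s : ℕ → ℝ) (hv : ∀ i ∈ I, 0 ≤ v i) :
    2 * ∑ j ∈ I, ∑ i ∈ I, v j * (if s i < s j then v i else 0) ≤ (∑ i ∈ I, v i) ^ 2 := by
  have h1 : ∑ j ∈ I, ∑ i ∈ I, v j * (if s i < s j then v i else 0)
      = ∑ j ∈ I, ∑ i ∈ I, v i * (if s j < s i then v j else 0) := Finset.sum_comm
  have h2 : (∑ i ∈ I, v i) ^ 2 = ∑ j ∈ I, ∑ i ∈ I, v j * v i := by
    rw [sq, Finset.sum_mul_sum]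
  rw [two_mul]
  nth_rewrite 2 [h1]
  rw [h2, ← Finset.sum_add_distrib]
  refine Finset.sum_le_sum fun j hj => ?_
  rw [← Finset.sum_add_distrib]
  refine Finset.sum_le_sum fun i hi => ?_
  have := mul_nonneg (hv i hi) (hv j hj)
  split_ifs with h3 h4 h4
  · exact absurd h3 (not_lt.mpr h4.le)
  · linarith
  · linarith
  · linarith

lemma core_test (I : Finset ℕ) (v s : ℕ → ℝ) (u L : ℝ) (hL : 0 < L) (hu : 0 ≤ u)
    (hv : ∀ i ∈ I, 0 ≤ v i)
    (hV1 : ∑ i ∈ I, v i < 1)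
    (hq : u ≤ 1 - 2 * (∑ i ∈ I, v i) + (∑ i ∈ I, v i) ^ 2 / 2)
    (hj : ∀ j ∈ I, s j ≤ u * L + ∑ i ∈ I, s i * v i
      + ∑ i ∈ I, L * (if s i < s j then v i else 0))
    (hk : L < u * L + ∑ i ∈ I, s i * v i + L * ∑ i ∈ I, v i) : False := by
  have hp := pair_sum_le I v s hv
  set V := ∑ i ∈ I, v i with hVdef
  set S := ∑ i ∈ I, s i * v i with hSdef
  have hS : S ≤ (u * L + S) * V +
      L * ∑ j ∈ I, ∑ i ∈ I, v j * (if s i < s j then v i else 0) := by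
    calc S = ∑ j ∈ I, s j * v j := rfl
      _ ≤ ∑ j ∈ I, (u * L + S + ∑ i ∈ I, L * (if s i < s j then v i else 0)) * v j :=
        Finset.sum_le_sum fun j h => mul_le_mul_of_nonneg_right (hj j h) (hv j h)
      _ = _ := by
        simp only [add_mul _ (∑ i ∈ I, _) _]
        rw [Finset.sum_add_distrib, ← Finset.mul_sum, ← hVdef]
        congr 1
        rw [Finset.mul_sum]
        refine Finset.sum_congr rfl fun j _ => ?_
        rw [← Finset.mul_sum, ← Finset.mul_sum]
        ring
  set P := ∑ j ∈ I, ∑ i ∈ I, v j * (if s i < s j then v i else 0)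
  have h1 : L * P ≤ L * (V ^ 2 / 2) := mul_le_mul_of_nonneg_left (by linarith) hL.le
  have h2 : L * u ≤ L * (1 - 2 * V + V ^ 2 / 2) := mul_le_mul_of_nonneg_left hq hL.le
  have h3 := mul_lt_mul_of_pos_right hk (sub_pos.mpr hV1)
  nlinarith

lemma cond_quad (a u V : ℝ) (ha : 0 < a) (ha1 : a < 1) (hu : 0 ≤ u) (hV : 0 ≤ V)
    (h : V ≤ a * (2 - Real.sqrt (2 + 2 * u * a⁻¹))) :
    V < 1 ∧ u ≤ 1 - 2 * V + V ^ 2 / 2 := by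
  have hq : (0:ℝ) ≤ u * a⁻¹ := by positivity
  set r := Real.sqrt (2 + 2 * u * a⁻¹) with hr
  have hr0 : 0 ≤ r := Real.sqrt_nonneg _
  have hr2 : r ^ 2 = 2 + 2 * u * a⁻¹ := Real.sq_sqrt (by nlinarith)
  have hr1 : 1 ≤ r := by nlinarith
  have hVa : V ≤ a := by nlinarith
  have h5 : (a * r) ^ 2 = 2 * a ^ 2 + 2 * u * a := by
    rw [mul_pow, hr2]; field_simp
  have h6 : a * r ≤ 2 * a - V := by linarith
  have h7 : (a * r) ^ 2 ≤ (2 * a - V) ^ 2 := by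
    apply pow_le_pow_left₀ (by positivity) h6
  refine ⟨by linarith, ?_⟩
  have h8 : V ^ 2 ≤ a := by nlinarith
  have h9 : 0 ≤ (1 - a) * (2 * a - V ^ 2) := mul_nonneg (by linarith) (by linarith)
  have : a * u ≤ a * (1 - 2 * V + V ^ 2 / 2) := by nlinarith
  exact le_of_mul_le_mul_left this ha

/-- Theorem 3, second condition, of the paper: the square-root utilization test for
global rate-monotonic scheduling on M processors implies the forced-forwarding
schedulability condition for task τ_k. -/
theorem stmt17 (M k : ℕ) (hM : 1 ≤ M) (hk : 2 ≤ k)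
    (T C U : ℕ → ℝ)
    (hT : ∀ i ∈ Finset.Icc 1 k, 0 < T i)
    (hC : ∀ i ∈ Finset.Icc 1 k, 0 ≤ C i)
    (hCk : 0 < C k)
    (hU : ∀ i ∈ Finset.Icc 1 k, U i = C i / T i)
    (hRM : ∀ i ∈ Finset.Icc 1 (k - 1), T i ≤ T k)
    (Umax : ℝ)
    (hUmax1 : ∀ j ∈ Finset.Icc 1 k, U j ≤ Umax)
    (hUmax2 : ∃ j ∈ Finset.Icc 1 k, Umax = U j)
    (hcond : (1 / (M : ℝ)) * (∑ j ∈ Finset.Icc 1 (k - 1), U j) ≤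
      (((k : ℝ) - 1) / k) *
        (2 - Real.sqrt (2 + 2 * Umax * ((k : ℝ) / ((k : ℝ) - 1))))) :
    ∀ y : ℝ, 0 ≤ y → ∀ ω : ℕ → ℝ,
      (∀ i ∈ Finset.Icc 1 (k - 1), 0 ≤ ω i ∧ ω i ≤ T i) →
      ∃ t : ℝ, 0 < t ∧ t ≤ T k + y ∧
        Umax * (T k + y) +
          (1 / (M : ℝ)) *
            (∑ i ∈ Finset.Icc 1 (k - 1), (ω i * U i + (⌈(t - ω i) / T i⌉ : ℝ) * C i))
          ≤ t := by
  intro y hy ω hω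
  by_contra! hcon
  have hkk : k ∈ Finset.Icc 1 k := Finset.mem_Icc.mpr ⟨by omega, le_rfl⟩
  have hsub : ∀ i ∈ Finset.Icc 1 (k - 1), i ∈ Finset.Icc 1 k := fun i hi => by
    rw [Finset.mem_Icc] at hi ⊢; omega
  have hTk := hT k hkk
  have hu : 0 ≤ Umax := by
    refine le_trans ?_ (hUmax1 k hkk)
    rw [hU k hkk]; positivity
  have hM0 : (0:ℝ) < M := by exact_mod_cast hM
  have hk2 : (2:ℝ) ≤ k := by exact_mod_cast hk
  set I := Finset.Icc 1 (k - 1) with hI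
  set L := T k + y with hLdef
  have hL : 0 < L := by linarith
  have hU0 : ∀ i ∈ I, 0 ≤ U i := fun i hi => by
    rw [hU i (hsub i hi)]; exact div_nonneg (hC i (hsub i hi)) (hT i (hsub i hi)).le
  have hCU : ∀ i ∈ I, C i = U i * T i := fun i hi => by
    rw [hU i (hsub i hi)]; have := hT i (hsub i hi); field_simp
  set v : ℕ → ℝ := fun i => (1 / (M:ℝ)) * U i with hvdef
  have hv : ∀ i ∈ I, 0 ≤ v i := fun i hi => mul_nonneg (by positivity) (hU0 i hi)
  rw [Finset.mul_sum] at hcond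
  have hV0 : 0 ≤ ∑ i ∈ I, v i := Finset.sum_nonneg hv
  obtain ⟨hV1, hq⟩ := cond_quad (((k:ℝ) - 1) / k) Umax (∑ i ∈ I, v i)
    (div_pos (by linarith) (by linarith)) (by rw [div_lt_one (by linarith)]; linarith)
    hu hV0 (by rw [inv_div]; exact hcond)
  set s : ℕ → ℝ := fun i => ω i + ((⌈(L - ω i) / T i⌉ : ℝ) - 1) * T i with hsdef
  have hs0 : ∀ i ∈ I, 0 ≤ s i := fun i hi => by
    have hTi := hT i (hsub i hi)
    have h1 := Int.le_ceil ((L - ω i) / T i)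
    rw [div_le_iff₀ hTi] at h1
    have := hRM i hi
    simp only [hsdef]; linarith
  have hsL : ∀ i ∈ I, s i ≤ L := fun i hi => by
    have hTi := hT i (hsub i hi)
    have h1 : ((⌈(L - ω i) / T i⌉ : ℝ) - 1) < (L - ω i) / T i := by
      linarith [Int.ceil_lt_add_one ((L - ω i) / T i)]
    rw [lt_div_iff₀ hTi] at h1
    simp only [hsdef]; linarith
  have hS0 : 0 ≤ ∑ i ∈ I, s i * v i :=
    Finset.sum_nonneg fun i hi => mul_nonneg (hs0 i hi) (hv i hi)
  -- value at t
  have hle : ∀ t ≤ L, ∀ i ∈ I, (1 / (M:ℝ)) * (ω i * U i + (⌈(t - ω i) / T i⌉ : ℝ) * C i)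
      ≤ s i * v i + L * (if s i < t then v i else 0) := fun t ht i hi => by
    have hTi := hT i (hsub i hi)
    have hTL : T i ≤ L := by linarith [hRM i hi]
    have hCi := hC i (hsub i hi)
    have key : ω i * U i + (⌈(t - ω i) / T i⌉ : ℝ) * C i
        ≤ s i * U i + L * (if s i < t then U i else 0) := by
      have hs : s i * U i = ω i * U i + ((⌈(L - ω i) / T i⌉ : ℝ) - 1) * C i := by
        rw [hCU i hi]; simp only [hsdef]; ring
      rw [hs]
      split_ifs with h
      · have h1 : (⌈(t - ω i) / T i⌉ : ℝ) ≤ (⌈(L - ω i) / T i⌉ : ℝ) := by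
          exact_mod_cast Int.ceil_le_ceil (by gcongr)
        have h2 := mul_le_mul_of_nonneg_right h1 hCi
        have h3 : C i ≤ L * U i := by
          rw [hCU i hi, mul_comm]; exact mul_le_mul_of_nonneg_right hTL (hU0 i hi)
        linarith
      · have h1 : ⌈(t - ω i) / T i⌉ ≤ ⌈(L - ω i) / T i⌉ - 1 := by
          rw [Int.ceil_le, div_le_iff₀ hTi]
          push_cast
          have := not_lt.mp h
          simp only [hsdef] at this; linarith
        have h1' : (⌈(t - ω i) / T i⌉ : ℝ) ≤ (⌈(L - ω i) / T i⌉ : ℝ) - 1 := by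
          exact_mod_cast h1
        have h2 := mul_le_mul_of_nonneg_right h1' hCi
        linarith
    have := mul_le_mul_of_nonneg_left key (by positivity : (0:ℝ) ≤ 1 / (M:ℝ))
    refine this.trans (le_of_eq ?_)
    simp only [hvdef]
    split_ifs <;> ring
  have hmain : ∀ t, 0 < t → t ≤ L → t < Umax * L + ∑ i ∈ I, s i * v i
      + ∑ i ∈ I, L * (if s i < t then v i else 0) := fun t ht htL => by
    have h1 := hcon t ht htL
    rw [Finset.mul_sum] at h1
    have h2 := Finset.sum_le_sum (hle t htL)
    rw [Finset.sum_add_distrib] at h2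
    linarith
  have hnn : ∀ t, ∀ i ∈ I, 0 ≤ L * (if s i < t then v i else 0) := fun t i hi => by
    have := hv i hi
    split_ifs <;> positivity
  refine core_test I v s Umax L hL hu hv hV1 hq ?_ ?_
  · intro j hj
    rcases (hs0 j hj).eq_or_lt with h | h
    · have := Finset.sum_nonneg (hnn (s j))
      have := mul_nonneg hu hL.le
      linarith
    · exact (hmain _ h (hsL j hj)).le
  · refine (hmain L hL le_rfl).trans_le ?_
    rw [Finset.mul_sum]
    gcongr with i hi
    have := hv i hi
    split_ifs <;> linarith
end

section
/- Let M ≥ 1 and k ≥ 2 be integers; for i = 1,…,k−1 let T_i > 0 and C_i ≥ 0 be reals with U_i = C_i/T_i, indexed so that T_1 ≥ T_2 ≥ … ≥ T_{k-1}; let C_k > 0 and reals T_k ≥ D > 0 with U_k = C_k/T_k, and set Δ = max{U_1,…,U_{k-1}, C_k/D}. If Σ_{i=1}^{k} U_i ≤ M, Σ_{i=1}^{k-1} C_i/D ≤ M, and Δ ≤ 1 − (1/M) · Σ_{i=1}^{k-1} (U_i + C_i/D) + (1/M²) · Σ_{i=1}^{k-1} U_i · (Σ_{ℓ=i}^{k-1}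 C_ℓ/D), then for every real y ≥ 0 and all reals ω_1,…,ω_{k-1} with 0 ≤ ω_i ≤ T_i there exists a real t with 0 < t ≤ D + y such that Δ · (D + y) + (1/M) · Σ_{i=1}^{k-1} (ω_i·U_i + ⌈(t − ω_i)/T_i⌉ · C_i) ≤ t. -/
open Finset

lemma pair_sum_s18 (n : ℕ) (T C U t : ℕ → ℝ)
    (hT : ∀ i ∈ Finset.Icc 1 n, 0 < T i)
    (hC : ∀ i ∈ Finset.Icc 1 n, 0 ≤ C i)
    (hU : ∀ i ∈ Finset.Icc 1 n, U i = C i / T i)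
    (hord : ∀ i ∈ Finset.Icc 1 n, ∀ j ∈ Finset.Icc 1 n, i ≤ j → T j ≤ T i) :
    (∑ i ∈ Finset.Icc 1 n, U i * ∑ l ∈ Finset.Icc i n, C l)
      + (∑ j ∈ Finset.Icc 1 n, U j * ∑ i ∈ Finset.Icc 1 n, if t i < t j then C i else 0)
      ≤ (∑ i ∈ Finset.Icc 1 n, U i) * ∑ i ∈ Finset.Icc 1 n, C i := by
  have hU0 : ∀ i ∈ Finset.Icc 1 n, 0 ≤ U i := fun i hi => by
    rw [hU i hi]; exact div_nonneg (hC i hi) (hT i hi).le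
  have h1 : ∀ i ∈ Finset.Icc 1 n, ∑ l ∈ Finset.Icc i n, C l
      = ∑ l ∈ Finset.Icc 1 n, if i ≤ l then C l else 0 := by
    intro i hi
    rw [← Finset.sum_filter]
    apply Finset.sum_congr _ (fun _ _ => rfl)
    ext l
    simp only [Finset.mem_Icc, Finset.mem_filter] at hi ⊢
    omega
  let h : ℕ → ℕ → ℝ := fun i j =>
    U i * (if i ≤ j then C j else 0) + U i * (if t j < t i then C j else 0) - U i * C j
  have key : ∑ i ∈ Finset.Icc 1 n, ∑ j ∈ Finset.Icc 1 n, (h i j + h j i) ≤ 0 := by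
    apply Finset.sum_nonpos; intro i hi
    apply Finset.sum_nonpos; intro j hj
    have hij : ∀ a ∈ Finset.Icc 1 n, ∀ b ∈ Finset.Icc 1 n, a ≤ b →
        U a * C b ≤ U b * C a := by
      intro a ha b hb hab
      rw [hU a ha, hU b hb, div_mul_eq_mul_div, div_mul_eq_mul_div, mul_comm (C b)]
      exact div_le_div_of_nonneg_left (mul_nonneg (hC a ha) (hC b hb)) (hT b hb)
        (hord a ha b hb hab)
    have p1 := mul_nonneg (hU0 i hi) (hC j hj)
    have p2 := mul_nonneg (hU0 j hj) (hC i hi)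
    simp only [h]
    rcases lt_trichotomy i j with hlt | heq | hgt
    · have := hij i hi j hj hlt.le
      rw [if_pos hlt.le, if_neg (not_le.mpr hlt)]
      split_ifs <;> linarith
    · subst heq; simp
    · have := hij j hj i hi hgt.le
      rw [if_pos hgt.le, if_neg (not_le.mpr hgt)]
      split_ifs <;> linarith
  have e2 : ∑ i ∈ Finset.Icc 1 n, ∑ j ∈ Finset.Icc 1 n, (h i j + h j i)
      = 2 * ∑ i ∈ Finset.Icc 1 n, ∑ j ∈ Finset.Icc 1 n, h i j := by
    simp only [Finset.sum_add_distrib]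
    rw [Finset.sum_comm (f := fun i j => h j i)]; ring
  have e3 : ∑ i ∈ Finset.Icc 1 n, ∑ j ∈ Finset.Icc 1 n, h i j
      = (∑ i ∈ Finset.Icc 1 n, U i * ∑ l ∈ Finset.Icc i n, C l)
      + (∑ j ∈ Finset.Icc 1 n, U j * ∑ i ∈ Finset.Icc 1 n, if t i < t j then C i else 0)
      - (∑ i ∈ Finset.Icc 1 n, U i) * ∑ i ∈ Finset.Icc 1 n, C i := by
    have h1' : ∑ i ∈ Finset.Icc 1 n, U i * ∑ l ∈ Finset.Icc i n, C l
        = ∑ i ∈ Finset.Icc 1 n, U i * ∑ l ∈ Finset.Icc 1 n, if i ≤ l then C l else 0 :=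
      Finset.sum_congr rfl (fun i hi => by rw [h1 i hi])
    rw [h1']
    simp only [h, Finset.sum_add_distrib, Finset.sum_sub_distrib, Finset.mul_sum, Finset.sum_mul]
    congr 1
    exact Finset.sum_comm
  linarith

lemma final_arith (m L D Δ u c P F S : ℝ) (hm : 0 < m) (hD : 0 < D) (hDL : D ≤ L)
    (hu : u < m) (hc : 0 ≤ c) (hF : 0 ≤ F)
    (hPF : P + F ≤ u * c)
    (hcond : Δ ≤ 1 - (1 / m) * (u + c / D) + (1 / m ^ 2) * (P / D))
    (hS : S ≤ (Δ * L + S / m) * u + F / m) :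
    Δ * L + (1 / m) * (S + c) ≤ L := by
  have h1 : 0 ≤ m * c - P := by nlinarith
  have h2 : (m * c - P) ≤ D * (m ^ 2 * (1 - Δ) - m * u) := by
    have : D * m ^ 2 * Δ ≤ D * m ^ 2 *
      (1 - (1 / m) * (u + c / D) + (1 / m ^ 2) * (P / D)) :=
      mul_le_mul_of_nonneg_left hcond (by positivity)
    have e : D * m ^ 2 * (1 - (1 / m) * (u + c / D) + (1 / m ^ 2) * (P / D))
      = D * m ^ 2 - D * m * u - m * c + P := by field_simp; ring
    nlinarith
  have h3 : 0 ≤ m ^ 2 * (1 - Δ) - m * u := by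
    by_contra hh
    push Not at hh
    nlinarith
  have h4 : m * c - P ≤ L * (m ^ 2 * (1 - Δ) - m * u) :=
    h2.trans (mul_le_mul_of_nonneg_right hDL h3)
  have h5 : S * (m - u) ≤ Δ * L * m * u + F := by
    have := mul_le_mul_of_nonneg_left hS hm.le
    have e : m * ((Δ * L + S / m) * u + F / m) = Δ * L * m * u + S * u + F := by
      field_simp
    linarith
  have h6 : (S + c) * (m - u) ≤ m * (L - Δ * L) * (m - u) := by nlinarith
  have h7 := le_of_mul_le_mul_right h6 (by linarith)
  have : (1 / m) * (S + c) ≤ L - Δ * L := by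
    rw [one_div, inv_mul_le_iff₀ hm]; exact h7
  linarith

lemma ceil_bounds (T C U ω L : ℝ) (hT : 0 < T) (hC : 0 ≤ C) (hU : U = C / T)
    (hL : 0 < L) (h0 : 0 ≤ ω) (h1 : ω ≤ T) :
    ∃ s : ℝ, 0 ≤ s ∧ s ≤ L ∧ ∀ t, 0 < t → t ≤ L →
      ω * U + (⌈(t - ω) / T⌉ : ℝ) * C ≤ s * U + (if s < t then C else 0) := by
  have hCU : C = U * T := by rw [hU]; field_simp
  have hU0 : 0 ≤ U := by rw [hU]; positivity
  have hfl := Int.floor_le ((L - ω) / T)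
  have hlf := Int.lt_floor_add_one ((L - ω) / T)
  set g := ⌊(L - ω) / T⌋ with hg
  rw [le_div_iff₀ hT] at hfl
  rw [div_lt_iff₀ hT] at hlf
  refine ⟨max 0 (ω + g * T), le_max_left _ _, max_le hL.le (by linarith), ?_⟩
  intro t ht htL
  have hs := le_max_right 0 (ω + g * T)
  have hsU := mul_le_mul_of_nonneg_right hs hU0
  split_ifs with hlt
  · have : ⌈(t - ω) / T⌉ ≤ g + 1 := by
      rw [Int.ceil_le, div_le_iff₀ hT]; push_cast; linarith
    have : (⌈(t - ω) / T⌉ : ℝ) ≤ g + 1 := by exact_mod_cast this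
    have := mul_le_mul_of_nonneg_right this hC
    nlinarith
  · have hle : t ≤ ω + g * T := by
      rcases le_max_iff.mp (not_lt.mp hlt) with h | h
      · linarith
      · exact h
    have : ⌈(t - ω) / T⌉ ≤ g := by
      rw [Int.ceil_le, div_le_iff₀ hT]; linarith
    have : (⌈(t - ω) / T⌉ : ℝ) ≤ g := by exact_mod_cast this
    have := mul_le_mul_of_nonneg_right this hC
    nlinarith

/-- Theorem 4 of the paper: the quadratic test for global fixed-priority scheduling of
constrained-deadline sporadic tasks on M processors implies the forced-forwarding
schedulability condition for task τ_k, with the higher-priority tasks ordered in a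
non-increasing order of their periods. -/
theorem stmt18 (M k : ℕ) (hM : 1 ≤ M) (hk : 2 ≤ k)
    (T C U : ℕ → ℝ)
    (hT : ∀ i ∈ Finset.Icc 1 (k - 1), 0 < T i)
    (hC : ∀ i ∈ Finset.Icc 1 (k - 1), 0 ≤ C i)
    (hU : ∀ i ∈ Finset.Icc 1 (k - 1), U i = C i / T i)
    (hord : ∀ i ∈ Finset.Icc 1 (k - 1), ∀ j ∈ Finset.Icc 1 (k - 1), i ≤ j →
      T j ≤ T i)
    (Tk Ck Uk D : ℝ) (hCk : 0 < Ck) (hD : 0 < D) (hDTk : D ≤ Tk)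
    (hUk : Uk = Ck / Tk)
    (Δ : ℝ)
    (hΔ1 : ∀ i ∈ Finset.Icc 1 (k - 1), U i ≤ Δ)
    (hΔ2 : Ck / D ≤ Δ)
    (hΔ3 : Δ = Ck / D ∨ ∃ i ∈ Finset.Icc 1 (k - 1), Δ = U i)
    (hsumU : (∑ i ∈ Finset.Icc 1 (k - 1), U i) + Uk ≤ (M : ℝ))
    (hsumC : ∑ i ∈ Finset.Icc 1 (k - 1), C i / D ≤ (M : ℝ))
    (hcond : Δ ≤ 1 - (1 / (M : ℝ)) * (∑ i ∈ Finset.Icc 1 (k - 1), (U i + C i / D))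
      + (1 / (M : ℝ) ^ 2) *
          (∑ i ∈ Finset.Icc 1 (k - 1), U i * ∑ l ∈ Finset.Icc i (k - 1), C l / D)) :
    ∀ y : ℝ, 0 ≤ y → ∀ ω : ℕ → ℝ,
      (∀ i ∈ Finset.Icc 1 (k - 1), 0 ≤ ω i ∧ ω i ≤ T i) →
      ∃ t : ℝ, 0 < t ∧ t ≤ D + y ∧
        Δ * (D + y) +
          (1 / (M : ℝ)) *
            (∑ i ∈ Finset.Icc 1 (k - 1), (ω i * U i + (⌈(t - ω i) / T i⌉ : ℝ) * C i))
          ≤ t := by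
  intro y hy ω hω
  have hm : (0 : ℝ) < M := by exact_mod_cast hM
  have hL : 0 < D + y := by linarith
  have hΔ0 : 0 < Δ := lt_of_lt_of_le (by positivity) hΔ2
  have hUk0 : 0 < Uk := by rw [hUk]; exact div_pos hCk (by linarith)
  have hU0 : ∀ i ∈ Finset.Icc 1 (k - 1), 0 ≤ U i := fun i hi => by
    rw [hU i hi]; exact div_nonneg (hC i hi) (hT i hi).le
  have hex : ∀ i, ∃ s : ℝ, i ∈ Finset.Icc 1 (k - 1) → (0 ≤ s ∧ s ≤ D + y ∧
      ∀ t, 0 < t → t ≤ D + y → ω i * U i + (⌈(t - ω i) / T i⌉ : ℝ) * C i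
        ≤ s * U i + (if s < t then C i else 0)) := by
    intro i
    by_cases hi : i ∈ Finset.Icc 1 (k - 1)
    · obtain ⟨s, hs⟩ := ceil_bounds (T i) (C i) (U i) (ω i) (D + y) (hT i hi) (hC i hi)
        (hU i hi) hL (hω i hi).1 (hω i hi).2
      exact ⟨s, fun _ => hs⟩
    · exact ⟨0, fun h => absurd h hi⟩
  choose s hs using hex
  set S := ∑ i ∈ Finset.Icc 1 (k - 1), s i * U i with hSdef
  have hS0 : 0 ≤ S := Finset.sum_nonneg fun i hi => mul_nonneg (hs i hi).1 (hU0 i hi)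
  have hW : ∀ t, 0 < t → t ≤ D + y →
      Δ * (D + y) + (1 / (M : ℝ)) *
        (∑ i ∈ Finset.Icc 1 (k - 1), (ω i * U i + (⌈(t - ω i) / T i⌉ : ℝ) * C i))
      ≤ Δ * (D + y) + (1 / (M : ℝ)) *
        (S + ∑ i ∈ Finset.Icc 1 (k - 1), if s i < t then C i else 0) := by
    intro t ht htL
    rw [hSdef, ← Finset.sum_add_distrib]
    refine add_le_add le_rfl (mul_le_mul_of_nonneg_left (Finset.sum_le_sum ?_) (by positivity))
    intro i hi
    exact (hs i hi).2.2 t ht htL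
  by_contra hno
  push Not at hno
  have hlt : ∀ t, 0 < t → t ≤ D + y → t < Δ * (D + y) + (1 / (M : ℝ)) *
        (S + ∑ i ∈ Finset.Icc 1 (k - 1), if s i < t then C i else 0) :=
    fun t ht htL => lt_of_lt_of_le (hno t ht htL) (hW t ht htL)
  have hnn : ∀ t, 0 ≤ ∑ i ∈ Finset.Icc 1 (k - 1), if s i < t then C i else 0 := by
    intro t
    apply Finset.sum_nonneg; intro i hi
    split_ifs
    · exact hC i hi
    · exact le_rfl
  have hj : ∀ j ∈ Finset.Icc 1 (k - 1), s j ≤ Δ * (D + y) + (1 / (M : ℝ)) *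
        (S + ∑ i ∈ Finset.Icc 1 (k - 1), if s i < s j then C i else 0) := by
    intro j hj
    rcases (hs j hj).1.eq_or_lt with h | h
    · have := hnn (s j)
      rw [← h] at this ⊢
      positivity
    · exact (hlt _ h (hs j hj).2.1).le
  have hpair := pair_sum_s18 (k - 1) T C U s hT hC hU hord
  set F := ∑ j ∈ Finset.Icc 1 (k - 1), U j *
    ∑ i ∈ Finset.Icc 1 (k - 1), if s i < s j then C i else 0 with hF
  set P := ∑ i ∈ Finset.Icc 1 (k - 1), U i * ∑ l ∈ Finset.Icc i (k - 1), C l with hP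
  set c := ∑ i ∈ Finset.Icc 1 (k - 1), C i with hc
  set u := ∑ i ∈ Finset.Icc 1 (k - 1), U i with hu
  have hfin := final_arith M (D + y) D Δ u c P F S hm hD (by linarith) (by linarith)
    (Finset.sum_nonneg hC)
    (Finset.sum_nonneg fun j hj => mul_nonneg (hU0 j hj) (hnn _)) hpair
    (by
      simp only [← Finset.sum_div, Finset.sum_add_distrib, ← mul_div_assoc] at hcond
      rw [mul_div_assoc] at hcond
      exact hcond)
    (by
      have : S ≤ ∑ j ∈ Finset.Icc 1 (k - 1), (Δ * (D + y) + (1 / (M : ℝ)) *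
        (S + ∑ i ∈ Finset.Icc 1 (k - 1), if s i < s j then C i else 0)) * U j :=
        Finset.sum_le_sum fun j hj' => mul_le_mul_of_nonneg_right (hj j hj') (hU0 j hj')
      refine this.trans (le_of_eq ?_)
      clear_value S
      rw [hu, hF, Finset.mul_sum, Finset.sum_div, ← Finset.sum_add_distrib]
      apply Finset.sum_congr rfl
      intro j _
      ring)
  have h1 := hlt (D + y) hL le_rfl
  have h2 : (∑ i ∈ Finset.Icc 1 (k - 1), if s i < D + y then C i else 0) ≤ c := by
    apply Finset.sum_le_sum; intro i hi
    split_ifs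
    · exact le_rfl
    · exact hC i hi
  have h3 : (1 / (M : ℝ)) * (S + ∑ i ∈ Finset.Icc 1 (k - 1), if s i < D + y then C i else 0)
      ≤ (1 / (M : ℝ)) * (S + c) := by gcongr
  linarith
end
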